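/- (Key Lemma) Let I be a compact interval of ℝ, let f: I → I be an interval map of class C^3 with non-flat critical points that is topologically exact, and let ν be an f-invariant ergodic Borel probability measure on I whose Lyapunov exponent χ_ν(f) = ∫ ln|f'| dν is strictly positive. Then for every Hölder continuous function φ: I → ℝ there is a set of full ν-measure of points x₀ in I such that limsup_{n→∞} (1/n) log Σ_{y ∈ f^{−n}(x₀)} exp(S_n(φ)(y)) > ∫_I φ dν. -/

import Mathlib

open MeasureTheory Filter Set Metric

noncomputable section

/-- Shannon entropy of the law of a finitely-valued map `p` under the measure `μ`. -/
def partitionEntropy {X ι : Type*} [MeasurableSpace X] [Fintype ι]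
    (μ : Measure X) (p : X → ι) : ℝ :=
  ∑ i, Real.negMulLog (μ (p ⁻¹' {i})).toReal

/-- Kolmogorov–Sinai (measure-theoretic) entropy of `f` with respect to `μ`:
the supremum over finite measurable partitions (coded by maps into `Fin k`) of the
limit (here: infimum, by subadditivity) of the normalized entropies of the joins. -/
def ksEntropy {X : Type*} [MeasurableSpace X] (μ : Measure X) (f : X → X) : ℝ :=
  ⨆ k : ℕ, ⨆ p : { p : X → Fin k // Measurable p },
    ⨅ n : ℕ, partitionEntropy μ (fun x (i : Fin (n + 1)) => p.1 (f^[(i : ℕ)] x)) / (n + 1)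

/-- `μ` is an `f`-invariant Borel probability measure giving full mass to `I`. -/
def InvariantProb (f : ℝ → ℝ) (I : Set ℝ) (μ : Measure ℝ) : Prop :=
  IsProbabilityMeasure μ ∧ μ I = 1 ∧ ∀ A : Set ℝ, MeasurableSet A → μ (f ⁻¹' A) = μ A

/-- Topological pressure of `f : I → I` for the potential `φ`, defined via the
variational principle. -/
def pressure (f : ℝ → ℝ) (I : Set ℝ) (φ : ℝ → ℝ) : ℝ :=
  sSup { r : ℝ | ∃ μ : Measure ℝ, InvariantProb f I μ ∧ r = ksEntropy μ f + ∫ x, φ x ∂μ }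

/-- An equilibrium state of `f` for the potential `φ`. -/
def IsEquilibriumState (f : ℝ → ℝ) (I : Set ℝ) (φ : ℝ → ℝ) (μ : Measure ℝ) : Prop :=
  InvariantProb f I μ ∧ ksEntropy μ f + ∫ x, φ x ∂μ = pressure f I φ

/-- `φ` is Hölder continuous on `I`. -/
def HolderOn (φ : ℝ → ℝ) (I : Set ℝ) : Prop :=
  ∃ C α : ℝ, 0 < α ∧ α ≤ 1 ∧ 0 ≤ C ∧ ∀ x ∈ I, ∀ y ∈ I, |φ x - φ y| ≤ C * |x - y| ^ α

/-- `φ` is hyperbolic for `f`: for some `n ≥ 1`, `sup_I (1/n) Sₙ(φ) < P(f, φ)`. -/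
def HyperbolicPotential (f : ℝ → ℝ) (I : Set ℝ) (φ : ℝ → ℝ) : Prop :=
  ∃ n : ℕ, 1 ≤ n ∧ sSup ((fun x => birkhoffSum f φ n x / n) '' I) < pressure f I φ

/-- `g` is a `C³` diffeomorphism of `ℝ`. -/
def IsC3Diffeo (g : ℝ → ℝ) : Prop :=
  ContDiff ℝ 3 g ∧ Function.Bijective g ∧ ∀ x, deriv g x ≠ 0

/-- `f` is an interval map of class `C³` with non-flat critical points on `I = [a, b]`. -/
structure IsC3NonflatIntervalMap (f : ℝ → ℝ) (a b : ℝ) : Prop where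
  lt : a < b
  mapsTo : MapsTo f (Icc a b) (Icc a b)
  diff : ∀ x ∈ Icc a b, DifferentiableAt ℝ f x
  critFinite : {x | x ∈ Icc a b ∧ deriv f x = 0}.Finite
  smooth : ContDiffOn ℝ 3 f ((Icc a b) \ {x | deriv f x = 0})
  nonflat : ∀ c ∈ Icc a b, deriv f c = 0 →
    ∃ ℓ : ℝ, 1 < ℓ ∧ ∃ φ ψ : ℝ → ℝ, IsC3Diffeo φ ∧ IsC3Diffeo ψ ∧
      φ c = 0 ∧ ψ (f c) = 0 ∧
      ∀ᶠ x in nhdsWithin c (Icc a b), |ψ (f x)| = |φ x| ^ ℓ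

/-- `f : I → I` is topologically exact. -/
def TopExact (f : ℝ → ℝ) (I : Set ℝ) : Prop :=
  ∀ U : Set ℝ, IsOpen U → (U ∩ I).Nonempty → ∃ n : ℕ, 1 ≤ n ∧ f^[n] '' (U ∩ I) = I

/-- `μ` is an `f`-invariant **ergodic** Borel probability measure on `I`. -/
def ErgodicProb (f : ℝ → ℝ) (I : Set ℝ) (μ : Measure ℝ) : Prop :=
  InvariantProb f I μ ∧
    ∀ A : Set ℝ, MeasurableSet A → f ⁻¹' A = A → μ A = 0 ∨ μ A = 1

/-- `Σ_{y ∈ f^{-n}(x₀) ∩ I} exp(Sₙ(φ)(y))`, as a finite sum (`finsum`);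
for interval maps in our class each preimage set is finite. -/
def preimSum (f φ : ℝ → ℝ) (I : Set ℝ) (n : ℕ) (x₀ : ℝ) : ℝ :=
  ∑ᶠ y ∈ {y | y ∈ I ∧ f^[n] y = x₀}, Real.exp (birkhoffSum f φ n y)

/-- A topologically exact self-map of a compact interval is onto. -/
lemma TopExact.exists_preimage {f : ℝ → ℝ} {a b : ℝ} (hex : TopExact f (Icc a b))
    (hab : a < b) (hm : MapsTo f (Icc a b) (Icc a b)) {y : ℝ} (hy : y ∈ Icc a b) :
    ∃ x ∈ Icc a b, f x = y := by
  obtain ⟨n, hn, h⟩ := hex univ isOpen_univ ⟨a, mem_univ _, le_rfl, hab.le⟩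
  rw [univ_inter] at h
  rw [← h] at hy
  obtain ⟨x, hx, rfl⟩ := hy
  obtain ⟨k, rfl⟩ : ∃ k, n = k + 1 := ⟨n - 1, by omega⟩
  exact ⟨f^[k] x, hm.iterate k hx, (Function.iterate_succ_apply' f k x).symm⟩

lemma TopExact.exists_preimage_iterate {f : ℝ → ℝ} {a b : ℝ} (hex : TopExact f (Icc a b))
    (hab : a < b) (hm : MapsTo f (Icc a b) (Icc a b)) (n : ℕ) :
    ∀ y ∈ Icc a b, ∃ x ∈ Icc a b, f^[n] x = y := by
  induction n with
  | zero => exact fun y hy => ⟨y, hy, rfl⟩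
  | succ n ih =>
    intro y hy
    obtain ⟨z, hz, rfl⟩ := hex.exists_preimage hab hm hy
    obtain ⟨x, hx, rfl⟩ := ih z hz
    exact ⟨x, hx, Function.iterate_succ_apply' f n x⟩

/-- Intervals of length at least `δ` are mapped onto the whole interval in a uniform time. -/
lemma TopExact.exists_uniform {f : ℝ → ℝ} {a b : ℝ} (hex : TopExact f (Icc a b))
    (hab : a < b) (hm : MapsTo f (Icc a b) (Icc a b)) {δ : ℝ} (hδ : 0 < δ) :
    ∃ N : ℕ, ∀ u v : ℝ, a ≤ u → v ≤ b → u + δ ≤ v → ∀ n, N ≤ n → ∀ y ∈ Icc a b,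
      ∃ x ∈ Icc u v, f^[n] x = y := by
  set h := δ / 3 with hh
  have hpos : 0 < h := by positivity
  have key : ∀ k : ℕ, ∃ n : ℕ, (Ioo (a + k * h) (a + k * h + h) ∩ Icc a b).Nonempty →
      f^[n] '' (Ioo (a + k * h) (a + k * h + h) ∩ Icc a b) = Icc a b := by
    intro k
    by_cases hk : (Ioo (a + k * h) (a + k * h + h) ∩ Icc a b).Nonempty
    · obtain ⟨n, -, hn⟩ := hex _ isOpen_Ioo hk
      exact ⟨n, fun _ => hn⟩
    · exact ⟨0, fun h => absurd h hk⟩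
  choose n hn using key
  set K := ⌈(b - a) / h⌉₊ with hK
  refine ⟨(Finset.range (K + 1)).sup n, fun u v hu hv huv m hmN y hy => ?_⟩
  set k := ⌈(u - a) / h⌉₊ with hkdef
  have hkK : k ≤ K := by
    apply Nat.ceil_le_ceil
    apply div_le_div_of_nonneg_right _ hpos.le
    linarith
  have hk1 : u ≤ a + k * h := by
    have := Nat.le_ceil ((u - a) / h)
    rw [div_le_iff₀ hpos] at this
    rw [hkdef]; linarith
  have hk2 : a + k * h < u + h := by
    have := Nat.ceil_lt_add_one (a := (u - a) / h) (div_nonneg (by linarith) hpos.le)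
    rw [← sub_lt_iff_lt_add, lt_div_iff₀ hpos] at this
    rw [hkdef]; linarith
  have hsub : Ioo (a + k * h) (a + k * h + h) ⊆ Icc u v := fun z hz =>
    ⟨hk1.trans hz.1.le, by linarith [hz.2]⟩
  have hne : (Ioo (a + k * h) (a + k * h + h) ∩ Icc a b).Nonempty :=
    ⟨a + k * h + h / 2, ⟨by linarith, by linarith⟩, by linarith, by linarith⟩
  have hnm : n k ≤ m :=
    (Finset.le_sup (f := n) (Finset.mem_range.2 (Nat.lt_succ_of_le hkK))).trans hmN
  obtain ⟨j, rfl⟩ := Nat.exists_eq_add_of_le' hnm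
  obtain ⟨z, hz, rfl⟩ := hex.exists_preimage_iterate hab hm j y hy
  rw [← hn k hne] at hz
  obtain ⟨x, hx, rfl⟩ := hz
  exact ⟨x, hsub hx.1, Function.iterate_add_apply f j (n k) x⟩

lemma continuousOn_iterate {f : ℝ → ℝ} {s : Set ℝ} (hc : ContinuousOn f s) (hm : MapsTo f s s)
    (n : ℕ) : ContinuousOn f^[n] s := by
  induction n with
  | zero => exact continuousOn_id
  | succ n ih =>
    rw [Function.iterate_succ]
    exact ih.comp hc hm

/-- Intervals of length at least `ε` never become short under iteration. -/
lemma TopExact.exists_expand {f : ℝ → ℝ} {a b : ℝ} (hex : TopExact f (Icc a b))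
    (hab : a < b) (hm : MapsTo f (Icc a b) (Icc a b)) (hc : ContinuousOn f (Icc a b))
    {ε : ℝ} (hε : 0 < ε) :
    ∃ δ > 0, ∀ u v : ℝ, a ≤ u → v ≤ b → u + ε ≤ v → ∀ n,
      ∃ s ∈ Icc u v, ∃ t ∈ Icc u v, δ ≤ |f^[n] s - f^[n] t| := by
  obtain ⟨N, hN⟩ := hex.exists_uniform hab hm hε
  have huc : ∀ j : ℕ, ∃ δ > 0, ∀ s ∈ Icc a b, ∀ t ∈ Icc a b, |s - t| < δ →
      |f^[j] s - f^[j] t| < b - a := by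
    intro j
    have := (isCompact_Icc (a := a) (b := b)).uniformContinuousOn_of_continuous
      (continuousOn_iterate hc hm j)
    rw [Metric.uniformContinuousOn_iff] at this
    obtain ⟨δ, hδ, h⟩ := this (b - a) (by linarith)
    exact ⟨δ, hδ, fun s hs t ht hst => h s hs t ht hst⟩
  choose δ hδ hδ' using huc
  have hne : (Finset.range (N + 1)).Nonempty := ⟨0, by simp⟩
  obtain ⟨j₀, -, hj₀⟩ := Finset.exists_min_image (Finset.range (N + 1)) δ hne
  refine ⟨min (δ j₀) (b - a), lt_min (hδ _) (by linarith), fun u v hu hv huv n => ?_⟩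
  have hsub : Icc u v ⊆ Icc a b := Icc_subset_Icc hu hv
  have ha : a ∈ Icc a b := ⟨le_rfl, hab.le⟩
  have hb : b ∈ Icc a b := ⟨hab.le, le_rfl⟩
  rcases le_total N n with h | h
  · obtain ⟨s, hs, hs'⟩ := hN u v hu hv huv n h b hb
    obtain ⟨t, ht, ht'⟩ := hN u v hu hv huv n h a ha
    refine ⟨s, hs, t, ht, ?_⟩
    rw [hs', ht', abs_of_pos (by linarith)]
    exact min_le_right _ _
  · obtain ⟨s, hs, hs'⟩ := hN u v hu hv huv N le_rfl b hb
    obtain ⟨t, ht, ht'⟩ := hN u v hu hv huv N le_rfl a ha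
    refine ⟨s, hs, t, ht, (min_le_left _ _).trans
      ((hj₀ (N - n) (Finset.mem_range.2 (by omega))).trans ?_)⟩
    by_contra! hlt
    have := hδ' (N - n) _ (hm.iterate n (hsub hs)) _ (hm.iterate n (hsub ht)) hlt
    rw [← Function.iterate_add_apply, ← Function.iterate_add_apply, Nat.sub_add_cancel h, hs',
      ht', abs_of_pos (by linarith)] at this
    exact lt_irrefl _ this

/-- Some pull-back of a short interval around `f^[n] x` stays close to the orbit of `x`
and still covers the whole interval in uniform time. -/
lemma TopExact.exists_shadow {f : ℝ → ℝ} {a b : ℝ} (hex : TopExact f (Icc a b))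
    (hab : a < b) (hm : MapsTo f (Icc a b) (Icc a b)) (hc : ContinuousOn f (Icc a b))
    {ε : ℝ} (hε : 0 < ε) :
    ∃ N : ℕ, ∀ x ∈ Icc a b, ∀ n : ℕ, ∀ y ∈ Icc a b, ∃ w ∈ Icc a b,
      f^[N] (f^[n] w) = y ∧ ∀ i ≤ n, |f^[i] w - f^[i] x| ≤ ε := by
  set ε' := min ε ((b - a) / 2) with hε'
  have hε'pos : 0 < ε' := lt_min hε (by linarith)
  have hε'1 : ε' ≤ ε := min_le_left _ _
  have hε'2 : ε' ≤ (b - a) / 2 := min_le_right _ _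
  obtain ⟨δ, hδ, hexp⟩ := hex.exists_expand hab hm hc hε'pos
  obtain ⟨N, hN⟩ := hex.exists_uniform hab hm (δ := δ / 4) (by positivity)
  refine ⟨N, fun x hx n y hy => ?_⟩
  obtain ⟨u, v, hu, hv, huv, hxuv, hlen⟩ : ∃ u v, a ≤ u ∧ v ≤ b ∧ u + ε' ≤ v ∧ x ∈ Icc u v ∧
      v - u ≤ ε' := by
    rcases le_total x ((a + b) / 2) with h | h
    · exact ⟨x, x + ε', hx.1, by linarith, le_rfl, ⟨le_rfl, by linarith⟩, by linarith⟩
    · exact ⟨x - ε', x, by linarith, hx.2, by linarith, ⟨by linarith, le_rfl⟩, by linarith⟩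
  have hsub : Icc u v ⊆ Icc a b := Icc_subset_Icc hu hv
  have hcn : ContinuousOn f^[n] (Icc a b) := continuousOn_iterate hc hm n
  obtain ⟨s, hs, hsδ⟩ : ∃ s ∈ Icc u v, δ / 2 ≤ |f^[n] s - f^[n] x| := by
    obtain ⟨s, hs, t, ht, hst⟩ := hexp u v hu hv huv n
    by_contra! hcon
    have h1 := hcon s hs
    have h2 := hcon t ht
    rw [abs_sub_comm] at h2
    have := abs_sub_le (f^[n] s) (f^[n] x) (f^[n] t)
    linarith
  -- the point closest to `x` whose image is at distance at least `δ / 4` from `f^[n] x`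
  have hmem : ∀ z ∈ uIcc x s, z ∈ Icc u v := fun z hz => by
    have := uIcc_subset_Icc hxuv hs hz
    exact this
  set g : ℝ → ℝ := fun z => |f^[n] z - f^[n] x| with hg
  have hgc : ContinuousOn g (Icc a b) := (hcn.sub continuousOn_const).abs
  set K : Set ℝ := {z | z ∈ uIcc x s ∧ δ / 4 ≤ g z} with hKdef
  have hKc : IsCompact K := by
    have h1 : IsClosed (uIcc x s ∩ g ⁻¹' Ici (δ / 4)) :=
      (hgc.mono fun z hz => hsub (hmem z hz)).preimage_isClosed_of_isClosed isClosed_Icc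
        isClosed_Ici
    have h2 := (isCompact_uIcc (a := x) (b := s)).inter_right h1
    convert h2 using 1
    ext z; simp [hKdef]
  have hKne : K.Nonempty := ⟨s, right_mem_uIcc, by simp only [hg]; linarith⟩
  obtain ⟨z₀, ⟨hz₀, hz₀'⟩, hzmin⟩ := hKc.exists_isMinOn hKne
    (f := fun z => |z - x|) (by fun_prop)
  -- orbits of the points between `x` and `z₀` stay near the orbit of `x`
  have hz₀uv := hmem z₀ hz₀
  have hin : ∀ w ∈ uIcc x z₀, g w ≤ δ / 4 := by
    intro w hw
    by_contra! hgw
    obtain ⟨w', hw', hgw'⟩ : ∃ w' ∈ uIcc x w, g w' = δ / 4 := by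
      have hcw : ContinuousOn g (uIcc x w) := hgc.mono fun z hz =>
        hsub (uIcc_subset_Icc hxuv (uIcc_subset_Icc hxuv hz₀uv hw) hz)
      have : g x = 0 := by simp [hg]
      exact intermediate_value_uIcc hcw (by
        rw [this, uIcc_of_le (by linarith)]; exact ⟨by linarith, hgw.le⟩)
    have hne : w' ≠ w := by rintro rfl; linarith
    have h1 : |z₀ - x| ≤ |w' - x| := by
      refine hzmin ⟨?_, hgw'.ge⟩
      have e1 : w ∈ uIcc x s := uIcc_subset_uIcc left_mem_uIcc hz₀ hw
      exact uIcc_subset_uIcc left_mem_uIcc e1 hw'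
    rcases le_total x z₀ with h | h
    · rw [uIcc_of_le h] at hw
      rw [uIcc_of_le hw.1] at hw'
      rw [abs_of_nonneg (by linarith), abs_of_nonneg (by linarith [hw'.1])] at h1
      exact hne (by linarith [hw.2, hw'.2])
    · rw [uIcc_of_ge h] at hw
      rw [uIcc_of_ge hw.2] at hw'
      rw [abs_of_nonpos (by linarith), abs_of_nonpos (by linarith [hw'.2])] at h1
      exact hne (by linarith [hw.1, hw'.1])
  have hz₀eq : δ / 4 ≤ |f^[n] z₀ - f^[n] x| := hz₀'
  obtain ⟨y', hy', hNy⟩ : ∃ y' ∈ uIcc (f^[n] x) (f^[n] z₀), f^[N] y' = y := by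
    have h1 := hm.iterate n (hsub hxuv)
    have h2 := hm.iterate n (hsub hz₀uv)
    rcases le_total (f^[n] x) (f^[n] z₀) with h | h
    · rw [abs_of_nonneg (by linarith)] at hz₀eq
      obtain ⟨y', hy', e⟩ := hN _ _ h1.1 h2.2 (by linarith) N le_rfl y hy
      exact ⟨y', by rwa [uIcc_of_le h], e⟩
    · rw [abs_of_nonpos (by linarith)] at hz₀eq
      obtain ⟨y', hy', e⟩ := hN _ _ h2.1 h1.2 (by linarith) N le_rfl y hy
      exact ⟨y', by rwa [uIcc_of_ge h], e⟩
  have hxz : uIcc x z₀ ⊆ Icc u v := uIcc_subset_Icc hxuv hz₀uv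
  obtain ⟨w, hw, rfl⟩ := intermediate_value_uIcc (hcn.mono (hxz.trans hsub)) hy'
  refine ⟨w, hsub (hxz hw), hNy, fun i hi => ?_⟩
  by_contra! hcon
  -- otherwise the image of `uIcc x w` under `f^[i]` is long, hence so is its image under `f^[n]`
  have hci : ContinuousOn f^[i] (Icc a b) := continuousOn_iterate hc hm i
  have hxw : uIcc x w ⊆ uIcc x z₀ := uIcc_subset_uIcc left_mem_uIcc hw
  have hsplit : ∀ p, f^[n] p = f^[n - i] (f^[i] p) := fun p => by
    rw [← Function.iterate_add_apply, Nat.sub_add_cancel hi]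
  have h1 := hm.iterate i (hsub hxuv)
  have h2 := hm.iterate i (hsub (hxz hw))
  obtain ⟨p, hp, q, hq, hpq⟩ : ∃ p ∈ uIcc (f^[i] x) (f^[i] w), ∃ q ∈ uIcc (f^[i] x) (f^[i] w),
      δ ≤ |f^[n - i] p - f^[n - i] q| := by
    rcases le_total (f^[i] x) (f^[i] w) with h | h
    · rw [abs_of_nonneg (by linarith)] at hcon
      rw [uIcc_of_le h]
      exact hexp _ _ h1.1 h2.2 (by linarith) (n - i)
    · rw [abs_of_nonpos (by linarith)] at hcon
      rw [uIcc_of_ge h]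
      exact hexp _ _ h2.1 h1.2 (by linarith) (n - i)
  have hcw := hci.mono ((hxw.trans hxz).trans hsub)
  obtain ⟨p', hp', rfl⟩ := intermediate_value_uIcc hcw hp
  obtain ⟨q', hq', rfl⟩ := intermediate_value_uIcc hcw hq
  rw [← hsplit, ← hsplit] at hpq
  have e1 := hin p' (hxw hp')
  have e2 := hin q' (hxw hq')
  simp only [hg] at e1 e2
  rw [abs_sub_comm] at e2
  have := abs_sub_le (f^[n] p') (f^[n] x) (f^[n] q')
  linarith

lemma IsC3NonflatIntervalMap.continuousOn {f : ℝ → ℝ} {a b : ℝ}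
    (hf : IsC3NonflatIntervalMap f a b) : ContinuousOn f (Icc a b) := fun x hx =>
  (hf.diff x hx).continuousAt.continuousWithinAt

lemma IsC3NonflatIntervalMap.continuousWithinAt_deriv {f : ℝ → ℝ} {a b : ℝ}
    (hf : IsC3NonflatIntervalMap f a b) {p : ℝ} (hp : p ∈ Icc a b) (hp' : deriv f p ≠ 0) :
    ContinuousWithinAt (deriv f) (Icc a b) p := by
  have hcl : IsClosed {x | x ∈ Icc a b ∧ deriv f x = 0} := hf.critFinite.isClosed
  have hop : {x | x ∈ Icc a b ∧ deriv f x = 0}ᶜ ∈ nhds p :=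
    hcl.isOpen_compl.mem_nhds (by simp [hp'])
  obtain ⟨r, hr, hball⟩ := Metric.mem_nhds_iff.1 hop
  have hab := hf.lt
  set J := Icc (max a (p - r / 2)) (min b (p + r / 2)) with hJ
  have hlt : max a (p - r / 2) < min b (p + r / 2) := by
    simp only [max_lt_iff, lt_min_iff]
    refine ⟨⟨hab, by linarith [hp.2]⟩, by linarith [hp.1], by linarith⟩
  have hJI : J ⊆ Icc a b := Icc_subset_Icc (le_max_left _ _) (min_le_left _ _)
  have hJS : J ⊆ Icc a b \ {x | deriv f x = 0} := by
    intro x hx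
    refine ⟨hJI hx, fun hx0 => ?_⟩
    have h1 : x ∈ Metric.ball p r := by
      rw [Metric.mem_ball, Real.dist_eq, abs_lt]
      have h2 := (le_max_right _ _).trans hx.1
      have h3 := hx.2.trans (min_le_right _ _)
      constructor <;> linarith
    exact hball h1 ⟨hJI hx, hx0⟩
  have hu : UniqueDiffOn ℝ J := uniqueDiffOn_Icc hlt
  have hcont := (hf.smooth.mono hJS).continuousOn_derivWithin hu (by norm_num)
  have hpJ : p ∈ J := ⟨by simp only [max_le_iff]; exact ⟨hp.1, by linarith⟩,
    by simp only [le_min_iff]; exact ⟨hp.2, by linarith⟩⟩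
  have heq : ∀ x ∈ J, derivWithin f J x = deriv f x := fun x hx =>
    (hf.diff x (hJI hx)).derivWithin (hu x hx)
  have h1 : ContinuousWithinAt (deriv f) J p :=
    ((hcont.congr fun x hx => (heq x hx).symm) p hpJ)
  refine h1.mono_of_mem_nhdsWithin ?_
  rw [mem_nhdsWithin_iff_exists_mem_nhds_inter]
  refine ⟨Metric.ball p (r / 2), Metric.ball_mem_nhds p (by positivity), fun x hx => ?_⟩
  have h2 := hx.1
  rw [Metric.mem_ball, Real.dist_eq, abs_lt] at h2
  exact ⟨max_le hx.2.1 (by linarith), le_min hx.2.2 (by linarith)⟩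

/-- Near a critical point, `|f'|` is a positive continuous function times a power of `|φ|`. -/
lemma IsC3NonflatIntervalMap.exists_deriv_eq {f : ℝ → ℝ} {a b : ℝ}
    (hf : IsC3NonflatIntervalMap f a b) {p : ℝ} (hp : p ∈ Icc a b) (hp' : deriv f p = 0) :
    ∃ s : ℝ, 0 < s ∧ ∃ φ G : ℝ → ℝ, ContDiff ℝ 1 φ ∧ ContinuousWithinAt G (Icc a b) p ∧
      0 < G p ∧ φ p = 0 ∧
      ∀ᶠ x in nhdsWithin p (Icc a b), |deriv f x| = G x * |φ x| ^ s := by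
  obtain ⟨ℓ, hℓ, φ, ψ, hφ, hψ, hφp, hψp, hev⟩ := hf.nonflat p hp hp'
  have hψc : Continuous (deriv ψ) := hψ.1.continuous_deriv (by norm_num)
  have hφc : Continuous (deriv φ) := hφ.1.continuous_deriv (by norm_num)
  have hfc : ContinuousWithinAt f (Icc a b) p := hf.continuousOn p hp
  refine ⟨ℓ - 1, by linarith, φ, fun x => ℓ * |deriv φ x| / |deriv ψ (f x)|,
    hφ.1.of_le (by norm_num), ?_, ?_, hφp, ?_⟩
  · apply ContinuousWithinAt.div
    · exact (continuous_const.mul hφc.abs).continuousWithinAt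
    · exact (hψc.abs.continuousAt.comp_continuousWithinAt hfc)
    · exact abs_ne_zero.2 (hψ.2.2 _)
  · have h1 := abs_pos.2 (hφ.2.2 p)
    have h2 := abs_pos.2 (hψ.2.2 (f p))
    positivity
  · have hev2 := eventually_eventually_nhdsWithin.2 hev
    filter_upwards [hev2, self_mem_nhdsWithin] with x hx hxI
    have hxe := hx.self_of_nhdsWithin hxI
    have hψ0 := hψ.2.2 (f x)
    by_cases hxp : x = p
    · subst hxp
      simp [hp', hφp, Real.zero_rpow (by linarith : ℓ - 1 ≠ 0)]
    have hφx : φ x ≠ 0 := fun h => hxp (hφ.2.1.1 (h.trans hφp.symm))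
    have hφpos := abs_pos.2 hφx
    have hψx : ψ (f x) ≠ 0 := by
      intro h
      rw [h, abs_zero] at hxe
      have := Real.rpow_pos_of_pos hφpos ℓ
      linarith
    have hdψ : HasDerivAt ψ (deriv ψ (f x)) (f x) :=
      (hψ.1.differentiable (by norm_num) _).hasDerivAt
    have hdφ : HasDerivAt φ (deriv φ x) x := (hφ.1.differentiable (by norm_num) _).hasDerivAt
    have hdf : HasDerivAt f (deriv f x) x := (hf.diff x hxI).hasDerivAt
    have h1 : HasDerivAt (fun y => Real.log (ψ (f y)))
        (deriv ψ (f x) * deriv f x / ψ (f x)) x := (hdψ.comp x hdf).log hψx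
    have h2 : HasDerivAt (fun y => ℓ * Real.log (φ y)) (ℓ * (deriv φ x / φ x)) x :=
      (hdφ.log hφx).const_mul ℓ
    have h3 : (fun y => Real.log (ψ (f y))) =ᶠ[nhdsWithin x (Icc a b)]
        fun y => ℓ * Real.log (φ y) := by
      have hne : ∀ᶠ y in nhdsWithin x (Icc a b), φ y ≠ 0 :=
        (hφ.1.continuous.continuousAt.eventually_ne hφx).filter_mono nhdsWithin_le_nhds
      filter_upwards [hx, hne] with y hy hy0
      rw [← Real.log_abs, hy, Real.log_rpow (abs_pos.2 hy0), Real.log_abs]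
    have h4 := (h2.hasDerivWithinAt (s := Icc a b)).congr_of_eventuallyEq h3
      (h3.self_of_nhdsWithin hxI)
    have h5 := (uniqueDiffOn_Icc hf.lt x hxI).eq_deriv _
      (h1.hasDerivWithinAt (s := Icc a b)) h4
    have h6 : |deriv ψ (f x)| * |deriv f x| / |ψ (f x)| = ℓ * (|deriv φ x| / |φ x|) := by
      rw [← abs_mul, ← abs_div, h5, abs_mul, abs_div, abs_of_pos (by linarith : 0 < ℓ)]
    rw [hxe] at h6
    have hsplit : |φ x| ^ ℓ = |φ x| ^ (ℓ - 1) * |φ x| := by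
      rw [← Real.rpow_add_one hφpos.ne']; ring_nf
    have hpw : 0 < |φ x| ^ (ℓ - 1) := Real.rpow_pos_of_pos hφpos _
    rw [hsplit] at h6
    have hψpos := abs_pos.2 hψ0
    field_simp at h6 ⊢
    linarith

/-- The derivative is bounded, and has bounded distortion on balls
whose radius is a power of `|f'|`. -/
def DistortionOn (f : ℝ → ℝ) (I S : Set ℝ) (β : ℝ) : Prop :=
  ∃ A : ℕ, ∃ κ > 0, ∃ M : ℝ, ∀ x ∈ S, |deriv f x| ≤ M ∧ (deriv f x ≠ 0 → ∀ y ∈ I,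
    |y - x| ≤ κ * min 1 |deriv f x| ^ A → Real.exp (-β) * |deriv f x| ≤ |deriv f y|)

lemma DistortionOn.union {f : ℝ → ℝ} {I S T : Set ℝ} {β : ℝ} (hS : DistortionOn f I S β)
    (hT : DistortionOn f I T β) : DistortionOn f I (S ∪ T) β := by
  obtain ⟨A, κ, hκ, M, h⟩ := hS
  obtain ⟨A', κ', hκ', M', h'⟩ := hT
  have key : ∀ x, min κ κ' * min 1 |deriv f x| ^ (max A A') ≤ κ * min 1 |deriv f x| ^ A ∧
      min κ κ' * min 1 |deriv f x| ^ (max A A') ≤ κ' * min 1 |deriv f x| ^ A' := by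
    intro x
    have h0 : 0 ≤ min 1 |deriv f x| := le_min zero_le_one (abs_nonneg _)
    have h1 : min 1 |deriv f x| ≤ 1 := min_le_left _ _
    exact ⟨mul_le_mul (min_le_left _ _) (pow_le_pow_of_le_one h0 h1 (le_max_left _ _))
      (pow_nonneg h0 _) hκ.le, mul_le_mul (min_le_right _ _)
      (pow_le_pow_of_le_one h0 h1 (le_max_right _ _)) (pow_nonneg h0 _) hκ'.le⟩
  refine ⟨max A A', min κ κ', lt_min hκ hκ', max M M', fun x hx => ?_⟩
  rcases hx with hx | hx
  · exact ⟨(h x hx).1.trans (le_max_left _ _), fun h0 y hy hyx =>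
      (h x hx).2 h0 y hy (hyx.trans (key x).1)⟩
  · exact ⟨(h' x hx).1.trans (le_max_right _ _), fun h0 y hy hyx =>
      (h' x hx).2 h0 y hy (hyx.trans (key x).2)⟩

/-- A continuous positive function oscillates by a small factor near a point. -/
lemma exists_ball_mul_lt {G : ℝ → ℝ} {I : Set ℝ} {p : ℝ} (hG : ContinuousWithinAt G I p)
    (hp : 0 < G p) {β : ℝ} (hβ : 0 < β) :
    ∀ᶠ x in nhdsWithin p I, Real.exp (-(β / 2)) * G p < G x ∧ G x < Real.exp (β / 2) * G p := by
  refine (hG.eventually_const_lt ?_).and (hG.eventually_lt_const ?_)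
  · have : Real.exp (-(β / 2)) < 1 := by rw [Real.exp_lt_one_iff]; linarith
    nlinarith
  · have : 1 < Real.exp (β / 2) := Real.one_lt_exp_iff.2 (by linarith)
    nlinarith

lemma IsC3NonflatIntervalMap.distortionOn_nhds {f : ℝ → ℝ} {a b : ℝ}
    (hf : IsC3NonflatIntervalMap f a b) {β : ℝ} (hβ : 0 < β) {p : ℝ} (hp : p ∈ Icc a b) :
    ∃ t ∈ nhdsWithin p (Icc a b), DistortionOn f (Icc a b) t β := by
  by_cases hp' : deriv f p = 0
  · obtain ⟨s, hs, φ, G, hφ, hG, hGp, hφp, hev⟩ := hf.exists_deriv_eq hp hp'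
    have hGev := exists_ball_mul_lt hG hGp (half_pos hβ)
    obtain ⟨Λ, t, ht, hΛ⟩ := (hφ.contDiffAt (x := p)).exists_lipschitzOnWith
    have hφev : ∀ᶠ x in nhdsWithin p (Icc a b), |φ x| < 1 :=
      ((hφ.continuous.abs.continuousAt (x := p)).eventually_lt_const
        (by simp [hφp])).filter_mono nhdsWithin_le_nhds
    have hall := hev.and (hGev.and (hφev.and (nhdsWithin_le_nhds ht)))
    obtain ⟨r, hr, hball⟩ := Metric.mem_nhdsWithin_iff.1 hall
    have hb : ∀ x ∈ Icc a b, |x - p| < r → |deriv f x| = G x * |φ x| ^ s ∧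
        (Real.exp (-(β / 2 / 2)) * G p < G x ∧ G x < Real.exp (β / 2 / 2) * G p) ∧
        |φ x| < 1 ∧ x ∈ t := fun x hx hxr =>
      hball ⟨by rwa [Metric.mem_ball, Real.dist_eq], hx⟩
    set G₁ := Real.exp (β / 2 / 2) * G p with hG₁
    have hG₁pos : 0 < G₁ := by positivity
    set θ := Real.exp (-(β / 2 / s)) with hθ
    have hθ1 : 0 < 1 - θ := by
      have : θ < 1 := by rw [hθ, Real.exp_lt_one_iff]; simp; positivity
      linarith
    obtain ⟨A, hA⟩ := exists_nat_ge (1 / s)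
    set c := G₁ ^ (1 / s) with hc
    have hcpos : 0 < c := Real.rpow_pos_of_pos hG₁pos _
    set κ := min (r / 4) ((1 - θ) / ((Λ + 1) * c)) with hκ
    have hΛ1 : (0 : ℝ) < Λ + 1 := by positivity
    have hκpos : 0 < κ := lt_min (by positivity) (by positivity)
    refine ⟨Icc a b ∩ Metric.ball p (r / 2), inter_mem_nhdsWithin _
      (Metric.ball_mem_nhds p (by positivity)), A, κ, hκpos, G₁, ?_⟩
    rintro x ⟨hxI, hxr⟩
    rw [Metric.mem_ball, Real.dist_eq] at hxr
    obtain ⟨hx1, ⟨hx2, hx3⟩, hx4, hxt⟩ := hb x hxI (by linarith)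
    have hpw1 : |φ x| ^ s ≤ 1 := Real.rpow_le_one (abs_nonneg _) hx4.le hs.le
    have hpw0 : 0 ≤ |φ x| ^ s := Real.rpow_nonneg (abs_nonneg _) _
    have hGx : 0 < G x := lt_trans (by positivity) hx2
    refine ⟨by rw [hx1]; nlinarith, fun h0 y hyI hyx => ?_⟩
    set D := min 1 |deriv f x| with hD
    have hD0 : 0 < D := lt_min one_pos (abs_pos.2 h0)
    have hD1 : D ≤ 1 := min_le_left _ _
    have hyr : |y - x| ≤ r / 4 :=
      hyx.trans ((mul_le_of_le_one_right hκpos.le (pow_le_one₀ hD0.le hD1)).trans (min_le_left _ _))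
    obtain ⟨hy1, ⟨hy2, hy3⟩, hy4, hyt⟩ := hb y hyI (by
      have := abs_sub_le y x p; linarith)
    have hDA : D ^ A ≤ c * |φ x| := by
      have e1 : D ^ A ≤ D ^ (1 / s) := by
        rw [← Real.rpow_natCast]
        exact Real.rpow_le_rpow_of_exponent_ge hD0 hD1 hA
      have e2 : D ≤ G₁ * |φ x| ^ s := by
        refine (min_le_right _ _).trans ?_
        rw [hx1]; exact mul_le_mul_of_nonneg_right hx3.le hpw0
      have e3 : D ^ (1 / s) ≤ (G₁ * |φ x| ^ s) ^ (1 / s) :=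
        Real.rpow_le_rpow hD0.le e2 (by positivity)
      rw [Real.mul_rpow hG₁pos.le hpw0, ← Real.rpow_mul (abs_nonneg _),
        mul_one_div_cancel hs.ne', Real.rpow_one] at e3
      exact e1.trans e3
    have hlip : |φ y - φ x| ≤ (1 - θ) * |φ x| := by
      have e1 := hΛ.dist_le_mul y hyt x hxt
      rw [Real.dist_eq, Real.dist_eq] at e1
      calc |φ y - φ x| ≤ Λ * |y - x| := e1
        _ ≤ (Λ + 1) * |y - x| := by nlinarith [abs_nonneg (y - x)]
        _ ≤ (Λ + 1) * (((1 - θ) / ((Λ + 1) * c)) * (c * |φ x|)) := by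
          gcongr
          refine hyx.trans ?_
          gcongr
          exact min_le_right _ _
        _ = (1 - θ) * |φ x| := by field_simp
    have hφy : θ * |φ x| ≤ |φ y| := by
      have := abs_sub_abs_le_abs_sub (φ x) (φ y)
      rw [abs_sub_comm] at this
      linarith
    have hpow : Real.exp (-(β / 2)) * |φ x| ^ s ≤ |φ y| ^ s := by
      have e1 := Real.rpow_le_rpow (by positivity) hφy hs.le
      rw [Real.mul_rpow (by positivity) (abs_nonneg _), hθ, ← Real.exp_mul] at e1
      convert e1 using 3
      field_simp
    have hGG : Real.exp (-(β / 2)) * G x ≤ G y := by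
      have : Real.exp (-(β / 2)) * (Real.exp (β / 2 / 2) * G p)
          = Real.exp (-(β / 2 / 2)) * G p := by
        rw [← mul_assoc, ← Real.exp_add]; ring_nf
      have e := mul_le_mul_of_nonneg_left hx3.le (Real.exp_pos (-(β / 2))).le
      rw [this] at e
      linarith
    rw [hx1, hy1]
    calc Real.exp (-β) * (G x * |φ x| ^ s)
        = (Real.exp (-(β / 2)) * G x) * (Real.exp (-(β / 2)) * |φ x| ^ s) := by
          rw [show -β = -(β / 2) + -(β / 2) by ring, Real.exp_add]; ring
      _ ≤ G y * |φ y| ^ s := by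
          apply mul_le_mul hGG hpow (by positivity)
          exact (lt_trans (by positivity) hy2).le
  · have hc : ContinuousWithinAt (fun x => |deriv f x|) (Icc a b) p :=
      (hf.continuousWithinAt_deriv hp hp').abs
    have hev := exists_ball_mul_lt hc (abs_pos.2 hp') hβ
    obtain ⟨r, hr, hball⟩ := Metric.mem_nhdsWithin_iff.1 hev
    have hb : ∀ x ∈ Icc a b, |x - p| < r → Real.exp (-(β / 2)) * |deriv f p| < |deriv f x| ∧
        |deriv f x| < Real.exp (β / 2) * |deriv f p| := fun x hx hxr =>
      hball ⟨by rwa [Metric.mem_ball, Real.dist_eq], hx⟩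
    refine ⟨Icc a b ∩ Metric.ball p (r / 2), inter_mem_nhdsWithin _
      (Metric.ball_mem_nhds p (by positivity)), 0, r / 4, by positivity,
      Real.exp (β / 2) * |deriv f p|, ?_⟩
    rintro x ⟨hxI, hxr⟩
    rw [Metric.mem_ball, Real.dist_eq] at hxr
    have hx := hb x hxI (by linarith)
    refine ⟨hx.2.le, fun _ y hyI hyx => ?_⟩
    rw [pow_zero, mul_one] at hyx
    have hy := hb y hyI (by have := abs_sub_le y x p; linarith)
    have e := mul_le_mul_of_nonneg_left hx.2.le (Real.exp_pos (-β)).le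
    have : Real.exp (-β) * (Real.exp (β / 2) * |deriv f p|)
        = Real.exp (-(β / 2)) * |deriv f p| := by
      rw [← mul_assoc, ← Real.exp_add]; ring_nf
    linarith [hy.1]

lemma IsC3NonflatIntervalMap.distortionOn {f : ℝ → ℝ} {a b : ℝ}
    (hf : IsC3NonflatIntervalMap f a b) {β : ℝ} (hβ : 0 < β) :
    DistortionOn f (Icc a b) (Icc a b) β := by
  refine (isCompact_Icc (a := a) (b := b)).induction_on
    (p := fun S => DistortionOn f (Icc a b) S β) ⟨0, 1, one_pos, 0, by simp⟩ ?_ ?_ ?_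
  · rintro S T hST ⟨A, κ, hκ, M, h⟩
    exact ⟨A, κ, hκ, M, fun x hx => h x (hST hx)⟩
  · exact fun S T hS hT => hS.union hT
  · exact fun x hx => hf.distortionOn_nhds hβ hx

lemma exists_abs_deriv_mul_eq {f : ℝ → ℝ} {a b : ℝ} (hd : ∀ x ∈ Icc a b, DifferentiableAt ℝ f x)
    {ρ p q u v : ℝ} (hp : a ≤ p) (hq : q ≤ b) (hρ : ∀ y ∈ Icc p q, ρ ≤ |deriv f y|)
    (hu : u ∈ Icc p q) (hv : v ∈ Icc p q) : ρ * |u - v| ≤ |f u - f v| := by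
  wlog huv : u < v generalizing u v with H
  · rcases (not_lt.1 huv).eq_or_lt with h | h
    · subst h; simp
    · rw [abs_sub_comm u, abs_sub_comm (f u)]; exact H hv hu h
  have hsub : Icc u v ⊆ Icc p q := Icc_subset_Icc hu.1 hv.2
  have hsub' : Icc p q ⊆ Icc a b := Icc_subset_Icc hp hq
  obtain ⟨c, hc, hc'⟩ := exists_deriv_eq_slope f huv
    (fun y hy => (hd y (hsub' (hsub hy))).continuousAt.continuousWithinAt)
    (fun y hy => (hd y (hsub' (hsub (Ioo_subset_Icc_self hy)))).differentiableWithinAt)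
  have h := hρ c (hsub (Ioo_subset_Icc_self hc))
  rw [hc', abs_div, le_div_iff₀ (abs_pos.2 (by linarith))] at h
  rwa [abs_sub_comm u, abs_sub_comm (f u)]

lemma strictMonoOn_or_strictAntiOn_of_deriv_ne_zero {f : ℝ → ℝ} {p q : ℝ}
    (hd : ∀ x ∈ Icc p q, DifferentiableAt ℝ f x) (h0 : ∀ x ∈ Icc p q, deriv f x ≠ 0) :
    StrictMonoOn f (Icc p q) ∨ StrictAntiOn f (Icc p q) := by
  have hc : ContinuousOn f (Icc p q) := fun y hy => (hd y hy).continuousAt.continuousWithinAt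
  rcases hasDerivWithinAt_forall_lt_or_forall_gt_of_forall_ne (convex_Icc p q)
    (fun x hx => (hd x hx).hasDerivAt.hasDerivWithinAt) h0 with h | h
  · exact Or.inr (strictAntiOn_of_deriv_neg (convex_Icc p q) hc fun x hx => h x (interior_subset hx))
  · exact Or.inl (strictMonoOn_of_deriv_pos (convex_Icc p q) hc fun x hx => h x (interior_subset hx))

/-- A ball on which `|f'| ≥ ρ`, and which meets no endpoint mapped to the interior,
covers the `ρ`-scaled ball around the image of its centre. -/
lemma exists_preimage_of_le_deriv {f : ℝ → ℝ} {a b : ℝ} (hab : a < b)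
    (hm : MapsTo f (Icc a b) (Icc a b)) (hd : ∀ x ∈ Icc a b, DifferentiableAt ℝ f x)
    {x r ρ : ℝ} (hx : x ∈ Icc a b) (hr : 0 ≤ r) (hρ : 0 < ρ)
    (hder : ∀ y ∈ Icc a b, |y - x| ≤ r → ρ ≤ |deriv f y|)
    (hea : |x - a| ≤ r → f a = a ∨ f a = b) (heb : |x - b| ≤ r → f b = a ∨ f b = b)
    {z : ℝ} (hz : z ∈ Icc a b) (hzx : |z - f x| ≤ ρ * r) :
    ∃ w ∈ Icc a b, f w = z ∧ |w - x| ≤ r := by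
  rcases hr.eq_or_lt with rfl | hr
  · rw [mul_zero] at hzx
    have := abs_nonpos_iff.1 hzx
    exact ⟨x, hx, by linarith, by simp⟩
  set p := max a (x - r) with hp
  set q := min b (x + r) with hq
  have hpx : p ≤ x := max_le hx.1 (by linarith)
  have hxq : x ≤ q := le_min hx.2 (by linarith)
  have hap : a ≤ p := le_max_left _ _
  have hqb : q ≤ b := min_le_left _ _
  have hpq : p < q := by
    simp only [hp, hq, max_lt_iff, lt_min_iff]
    exact ⟨⟨hab, by linarith [hx.1]⟩, by linarith [hx.2], by linarith⟩
  have hsub : Icc p q ⊆ Icc a b := Icc_subset_Icc hap hqb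
  have hball : ∀ y ∈ Icc p q, |y - x| ≤ r := fun y hy => by
    rw [abs_le]
    have h1 := (le_max_right a (x - r)).trans hy.1
    have h2 := hy.2.trans (min_le_right b (x + r))
    constructor <;> linarith
  have hρ' : ∀ y ∈ Icc p q, ρ ≤ |deriv f y| := fun y hy => hder y (hsub hy) (hball y hy)
  have hxm : x ∈ Icc p q := ⟨hpx, hxq⟩
  have hpm : p ∈ Icc p q := ⟨le_rfl, hpq.le⟩
  have hqm : q ∈ Icc p q := ⟨hpq.le, le_rfl⟩
  have hcont : ContinuousOn f (Icc p q) := fun y hy =>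
    (hd y (hsub hy)).continuousAt.continuousWithinAt
  have hlo := exists_abs_deriv_mul_eq hd hap hqb hρ' hpm hxm
  have hhi := exists_abs_deriv_mul_eq hd hap hqb hρ' hqm hxm
  have hfp := hm (hsub hpm)
  have hfq := hm (hsub hqm)
  rw [abs_le] at hzx
  -- the left endpoint is either far away or an endpoint of the whole interval
  have hpcase : p = x - r ∨ (f p = a ∨ f p = b) := by
    rcases le_total a (x - r) with h | h
    · exact Or.inl (max_eq_right h)
    · have e : p = a := max_eq_left h
      rw [e]
      exact Or.inr (hea (by rw [abs_of_nonneg (by linarith [hx.1])]; linarith))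
  have hqcase : q = x + r ∨ (f q = a ∨ f q = b) := by
    rcases le_total b (x + r) with h | h
    · have e : q = b := min_eq_left h
      rw [e]
      exact Or.inr (heb (by rw [abs_of_nonpos (by linarith [hx.2])]; linarith))
    · exact Or.inl (min_eq_right h)
  suffices hzmem : z ∈ f '' Icc p q by
    obtain ⟨w, hw, rfl⟩ := hzmem
    exact ⟨w, hsub hw, rfl, hball w hw⟩
  rcases strictMonoOn_or_strictAntiOn_of_deriv_ne_zero (fun y hy => hd y (hsub hy))
    (fun y hy h => by have := hρ' y hy; rw [h, abs_zero] at this; linarith) with hmono | hanti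
  · apply intermediate_value_Icc hpq.le hcont
    have h1 := hmono hpm hqm hpq
    have h2 := hmono.monotoneOn hpm hxm hpx
    have h3 := hmono.monotoneOn hxm hqm hxq
    rw [abs_of_nonpos (by linarith), abs_of_nonpos (by linarith)] at hlo
    rw [abs_of_nonneg (by linarith), abs_of_nonneg (by linarith)] at hhi
    constructor
    · rcases hpcase with h | h | h
      · rw [h] at hlo ⊢; ring_nf at hlo ⊢; linarith
      · rw [h]; exact hz.1
      · linarith [hfq.2]
    · rcases hqcase with h | h | h
      · rw [h] at hhi ⊢; ring_nf at hhi ⊢; linarith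
      · linarith [hfp.1]
      · rw [h]; exact hz.2
  · apply intermediate_value_Icc' hpq.le hcont
    have h1 := hanti hpm hqm hpq
    have h2 := hanti.antitoneOn hpm hxm hpx
    have h3 := hanti.antitoneOn hxm hqm hxq
    rw [abs_of_nonpos (by linarith), abs_of_nonneg (by linarith)] at hlo
    rw [abs_of_nonneg (by linarith), abs_of_nonpos (by linarith)] at hhi
    constructor
    · rcases hqcase with h | h | h
      · rw [h] at hhi ⊢; ring_nf at hhi ⊢; linarith
      · rw [h]; exact hz.1
      · linarith [hfp.2]
    · rcases hpcase with h | h | h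
      · rw [h] at hlo ⊢; ring_nf at hlo ⊢; linarith
      · linarith [hfq.1]
      · rw [h]; exact hz.2

/-- The image of a point with `f' ≠ 0` can be close to an endpoint `e` only if the point
itself is close to an endpoint mapped to `e`. -/
lemma exists_dist_endpoint {f : ℝ → ℝ} {a b : ℝ} (hab : a < b)
    (hm : MapsTo f (Icc a b) (Icc a b)) (hd : ∀ x ∈ Icc a b, DifferentiableAt ℝ f x)
    {β : ℝ} (hdist : DistortionOn f (Icc a b) (Icc a b) β) :
    ∃ B : ℕ, ∃ c > 0, ∀ y ∈ Icc a b, deriv f y ≠ 0 → ∀ e, (e = a ∨ e = b) →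
      c * min 1 |deriv f y| ^ B ≤ |f y - e| ∨
      ∃ e', (e' = a ∨ e' = b) ∧ f e' = e ∧ c * min 1 |deriv f y| ^ B * |y - e'| ≤ |f y - e| := by
  obtain ⟨A, κ, hκ, M, h⟩ := hdist
  have hc₀ : ∃ c₀ > 0, ∀ e, (e = a ∨ e = b) → ∀ e', (e' = a ∨ e' = b) → f e' ≠ e →
      c₀ ≤ |f e' - e| := by
    have : ∀ e e' : ℝ, ∃ c₀ > 0, f e' ≠ e → c₀ ≤ |f e' - e| := fun e e' => by
      by_cases hne : f e' = e
      · exact ⟨1, one_pos, fun h => absurd hne h⟩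
      · exact ⟨|f e' - e|, abs_pos.2 (sub_ne_zero.2 hne), fun _ => le_rfl⟩
    obtain ⟨c1, h1, k1⟩ := this a a
    obtain ⟨c2, h2, k2⟩ := this a b
    obtain ⟨c3, h3, k3⟩ := this b a
    obtain ⟨c4, h4, k4⟩ := this b b
    refine ⟨min (min c1 c2) (min c3 c4), by positivity, ?_⟩
    rintro e (rfl | rfl) e' (rfl | rfl) hne
    · exact ((min_le_left _ _).trans (min_le_left _ _)).trans (k1 hne)
    · exact ((min_le_left _ _).trans (min_le_right _ _)).trans (k2 hne)
    · exact ((min_le_right _ _).trans (min_le_left _ _)).trans (k3 hne)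
    · exact ((min_le_right _ _).trans (min_le_right _ _)).trans (k4 hne)
  obtain ⟨c₀, hc₀, hend⟩ := hc₀
  set g := Real.exp (-β) with hg
  have hgpos : 0 < g := Real.exp_pos _
  refine ⟨A + 1, min c₀ (min g (g * κ)), by positivity, fun y hy hy0 e he => ?_⟩
  set c := min c₀ (min g (g * κ)) with hc
  have hcpos : 0 < c := by positivity
  set D := min 1 |deriv f y| with hD
  have hD0 : 0 < D := lt_min one_pos (abs_pos.2 hy0)
  have hD1 : D ≤ 1 := min_le_left _ _
  have hDd : D ≤ |deriv f y| := min_le_right _ _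
  have hDA : D ^ A ≤ 1 := pow_le_one₀ hD0.le hD1
  have hDA1 : D ^ (A + 1) ≤ 1 := pow_le_one₀ hD0.le hD1
  have hDA2 : D ^ (A + 1) ≤ D := pow_le_of_le_one hD0.le hD1 (by omega)
  set r := κ * D ^ A with hr
  have hrpos : 0 < r := by positivity
  set p := max a (y - r) with hp
  set q := min b (y + r) with hq
  have hpy : p ≤ y := max_le hy.1 (by linarith)
  have hyq : y ≤ q := le_min hy.2 (by linarith)
  have hap : a ≤ p := le_max_left _ _
  have hqb : q ≤ b := min_le_left _ _
  have hsub : Icc p q ⊆ Icc a b := Icc_subset_Icc hap hqb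
  have hρ' : ∀ u ∈ Icc p q, g * D ≤ |deriv f u| := fun u hu => by
    refine (mul_le_mul_of_nonneg_left hDd hgpos.le).trans ((h y hy).2 hy0 u (hsub hu) ?_)
    rw [abs_le]
    have h1 := (le_max_right a (y - r)).trans hu.1
    have h2 := hu.2.trans (min_le_right b (y + r))
    constructor <;> linarith
  have hym : y ∈ Icc p q := ⟨hpy, hyq⟩
  have hpm : p ∈ Icc p q := ⟨le_rfl, hpy.trans hyq⟩
  have hqm : q ∈ Icc p q := ⟨hpy.trans hyq, le_rfl⟩
  -- moving towards `e` inside `Icc p q`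
  have hmove : ∃ u, (u = p ∨ u = q) ∧ |f y - e| = |f y - f u| + |f u - e| := by
    have habs : ∀ s t : ℝ, s ∈ Icc a b → t ∈ Icc a b →
        (e = a → s ≤ t) → (e = b → t ≤ s) → |t - e| = |t - s| + |s - e| := by
      intro s t hs ht h1 h2
      rcases he with rfl | rfl
      · rw [abs_of_nonneg (by linarith [ht.1]), abs_of_nonneg (by linarith [h1 rfl]),
          abs_of_nonneg (by linarith [hs.1])]; ring
      · rw [abs_of_nonpos (by linarith [ht.2]), abs_of_nonpos (by linarith [h2 rfl]),
          abs_of_nonpos (by linarith [hs.2])]; ring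
    have hfy := hm hy
    have hfp := hm (hsub hpm)
    have hfq := hm (hsub hqm)
    rcases strictMonoOn_or_strictAntiOn_of_deriv_ne_zero (fun y hy => hd y (hsub hy))
      (fun u hu h0 => by
        have h1 := hρ' u hu
        rw [h0, abs_zero] at h1
        have : 0 < g * D := by positivity
        linarith) with hmono | hanti
    · have h2 := hmono.monotoneOn hpm hym hpy
      have h3 := hmono.monotoneOn hym hqm hyq
      rcases he with h | h
      · exact ⟨p, Or.inl rfl, habs _ _ hfp hfy (fun _ => h2) (fun h' => by linarith)⟩
      · exact ⟨q, Or.inr rfl, habs _ _ hfq hfy (fun h' => by linarith) (fun _ => h3)⟩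
    · have h2 := hanti.antitoneOn hpm hym hpy
      have h3 := hanti.antitoneOn hym hqm hyq
      rcases he with h | h
      · exact ⟨q, Or.inr rfl, habs _ _ hfq hfy (fun _ => h3) (fun h' => by linarith)⟩
      · exact ⟨p, Or.inl rfl, habs _ _ hfp hfy (fun h' => by linarith) (fun _ => h2)⟩
  obtain ⟨u, hu, hueq⟩ := hmove
  have hum : u ∈ Icc p q := by rcases hu with rfl | rfl <;> assumption
  have hmvt := exists_abs_deriv_mul_eq hd hap hqb hρ' hym hum
  have hucase : |y - u| = r ∨ (u = a ∨ u = b) := by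
    rcases hu with rfl | rfl
    · rcases le_total a (y - r) with h | h
      · left
        rw [hp, max_eq_right h, abs_of_nonneg (by linarith)]; ring
      · exact Or.inr (Or.inl (max_eq_left h))
    · rcases le_total b (y + r) with h | h
      · exact Or.inr (Or.inr (min_eq_left h))
      · left
        rw [hq, min_eq_right h, abs_of_nonpos (by linarith)]; ring
  rcases hucase with hur | hue
  · left
    rw [hur] at hmvt
    calc c * D ^ (A + 1) ≤ (g * κ) * D ^ (A + 1) := by
          gcongr; exact (min_le_right _ _).trans (min_le_right _ _)
      _ = g * D * r := by rw [hr]; ring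
      _ ≤ |f y - e| := by rw [hueq]; linarith [abs_nonneg (f u - e)]
  · by_cases hfu : f u = e
    · right
      refine ⟨u, hue, hfu, ?_⟩
      calc c * D ^ (A + 1) * |y - u| ≤ g * D * |y - u| := by
            gcongr; exact (min_le_right _ _).trans (min_le_left _ _)
        _ ≤ |f y - e| := by rw [hueq]; linarith [abs_nonneg (f u - e)]
    · left
      calc c * D ^ (A + 1) ≤ c₀ * 1 := by
            gcongr; exact min_le_left _ _
        _ ≤ |f y - e| := by
            rw [hueq]; linarith [abs_nonneg (f y - f u), hend e he u hue hfu]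

/-- Two steps of a noncritical orbit control the distance to an endpoint whose image
is not an endpoint. -/
lemma exists_dist_bad_endpoint {f : ℝ → ℝ} {a b : ℝ} (hab : a < b)
    (hm : MapsTo f (Icc a b) (Icc a b)) (hd : ∀ x ∈ Icc a b, DifferentiableAt ℝ f x)
    {β : ℝ} (hdist : DistortionOn f (Icc a b) (Icc a b) β) :
    ∃ B : ℕ, ∃ c > 0, ∀ u ∈ Icc a b, deriv f u ≠ 0 → deriv f (f u) ≠ 0 →
      ∀ e, (e = a ∨ e = b) → ¬ (f e = a ∨ f e = b) →
      c * (min 1 |deriv f u| ^ B * min 1 |deriv f (f u)| ^ B) ≤ |f (f u) - e| := by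
  obtain ⟨B, c, hc, h⟩ := exists_dist_endpoint hab hm hd hdist
  refine ⟨B, min c (c * c), by positivity, fun u hu hu0 hfu0 e he hbad => ?_⟩
  set D := min 1 |deriv f u| ^ B with hD
  set D' := min 1 |deriv f (f u)| ^ B with hD'
  have hD0 : 0 ≤ D := by positivity
  have hD'0 : 0 ≤ D' := by positivity
  have hD1 : D ≤ 1 := pow_le_one₀ (by positivity) (min_le_left _ _)
  rcases h (f u) (hm hu) hfu0 e he with h1 | ⟨e', he', hfe', h1⟩
  · calc min c (c * c) * (D * D') ≤ c * (1 * D') := by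
          gcongr; exact min_le_left _ _
      _ ≤ _ := by rw [one_mul]; exact h1
  · rcases h u hu hu0 e' he' with h2 | ⟨e'', he'', hfe'', -⟩
    · calc min c (c * c) * (D * D') ≤ (c * c) * (D * D') := by
            gcongr; exact min_le_right _ _
        _ = c * D' * (c * D) := by ring
        _ ≤ c * D' * |f u - e'| := by gcongr
        _ ≤ _ := h1
    · exfalso
      subst hfe' hfe''
      rcases he'' with rfl | rfl <;> rcases he' with h3 | h3 <;> rcases he with h4 | h4 <;>
        simp_all

/-- A ball around the time-`t` point of an orbit can be pulled back along the orbit as long as the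
distortion is controlled at the natural scales. -/
lemma exists_pullback {f : ℝ → ℝ} {a b : ℝ} (hab : a < b)
    (hm : MapsTo f (Icc a b) (Icc a b)) (hd : ∀ x ∈ Icc a b, DifferentiableAt ℝ f x)
    {x β δ : ℝ} {t : ℕ} (R : ℕ → ℝ) (hRt : R t = 1) (hR0 : ∀ i, 0 < R i)
    (hRs : ∀ i, i < t → Real.exp (-β) * |deriv f (f^[i] x)| * R i = R (i + 1))
    (hx : x ∈ Icc a b) (s : ℕ) (hst : s ≤ t)
    (h : ∀ i, s ≤ i → i < t → deriv f (f^[i] x) ≠ 0 ∧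
      (∀ y ∈ Icc a b, |y - f^[i] x| ≤ δ * R i →
        Real.exp (-β) * |deriv f (f^[i] x)| ≤ |deriv f y|) ∧
      (|f^[i] x - a| ≤ δ * R i → f a = a ∨ f a = b) ∧
      (|f^[i] x - b| ≤ δ * R i → f b = a ∨ f b = b))
    {z : ℝ} (hz : z ∈ Icc a b) (hzt : |z - f^[t] x| ≤ δ) :
    ∃ w ∈ Icc a b, f^[t - s] w = z ∧
      ∀ i, s ≤ i → i ≤ t → |f^[i - s] w - f^[i] x| ≤ |z - f^[t] x| * R i := by
  induction hst using Nat.decreasingInduction with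
  | self =>
    refine ⟨z, hz, by simp, fun i h1 h2 => ?_⟩
    obtain rfl : i = t := le_antisymm h2 h1
    simp [hRt]
  | of_succ s hs ih =>
    obtain ⟨w', hw', hfw', hclose⟩ := ih fun i hi => h i (by omega)
    obtain ⟨h1, h2, h3, h4⟩ := h s le_rfl hs
    have hle : |z - f^[t] x| * R s ≤ δ * R s := mul_le_mul_of_nonneg_right hzt (hR0 s).le
    have hc := hclose (s + 1) le_rfl hs
    rw [Nat.sub_self, Function.iterate_zero, id, ← hRs s hs, Function.iterate_succ_apply'] at hc
    obtain ⟨w, hw, rfl, hwx⟩ := exists_preimage_of_le_deriv hab hm hd (hm.iterate s hx)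
      (r := |z - f^[t] x| * R s) (mul_nonneg (abs_nonneg _) (hR0 s).le)
      (ρ := Real.exp (-β) * |deriv f (f^[s] x)|) (mul_pos (Real.exp_pos _) (abs_pos.2 h1))
      (fun y hy hyx => h2 y hy (hyx.trans hle)) (fun h => h3 (h.trans hle))
      (fun h => h4 (h.trans hle)) hw' (hc.trans (le_of_eq (by ring)))
    refine ⟨w, hw, ?_, fun i hi hit => ?_⟩
    · rw [show t - s = t - (s + 1) + 1 by omega, Function.iterate_succ_apply, hfw']
    · rcases hi.eq_or_lt with rfl | hi
      · simpa using hwx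
      · rw [show i - s = i - (s + 1) + 1 by omega, Function.iterate_succ_apply]
        exact hclose i hi hit

/-- The expansion at a point, minus a penalty for being close to the critical set. -/
def hypWeight (f : ℝ → ℝ) (A : ℕ) (K β x : ℝ) : ℝ :=
  Real.log |deriv f x| - 2 * β - max 0 (-(A * Real.log |deriv f x|) - K)

/-- `t` is a hyperbolic time of `x` if all the sums of `hypWeight` ending at time `t`
are nonnegative. -/
def IsHypTime (f : ℝ → ℝ) (A : ℕ) (K β x : ℝ) (t : ℕ) : Prop :=
  ∀ i < t, 0 ≤ ∑ j ∈ Finset.Ico i t, hypWeight f A K β (f^[j] x)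

lemma exp_neg_penalty_le {A : ℕ} {K d : ℝ} (hK : 0 ≤ K) (hd : 0 < d) :
    Real.exp (-max 0 (-(A * Real.log d) - K)) ≤ Real.exp K * min 1 d ^ A := by
  rcases le_total 1 d with h | h
  · rw [min_eq_left h, one_pow, mul_one]
    exact Real.exp_le_exp.2 (by linarith [le_max_left 0 (-(A * Real.log d) - K)])
  · rw [min_eq_right h]
    have : d ^ A = Real.exp (A * Real.log d) := by
      rw [Real.exp_nat_mul, Real.exp_log hd]
    rw [this, ← Real.exp_add]
    exact Real.exp_le_exp.2 (by linarith [le_max_right 0 (-(A * Real.log d) - K)])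

lemma IsHypTime.exp_neg_sum_le {f : ℝ → ℝ} {A : ℕ} {K β x : ℝ} {t : ℕ}
    (h : IsHypTime f A K β x t) {i : ℕ} (hi : i ≤ t) :
    Real.exp (-∑ j ∈ Finset.Ico i t, (Real.log |deriv f (f^[j] x)| - β))
      ≤ Real.exp (-(β * (t - i : ℕ))) := by
  rcases hi.eq_or_lt with rfl | hi
  · simp
  apply Real.exp_le_exp.2
  have h1 := h i hi
  have h2 : ∑ j ∈ Finset.Ico i t, hypWeight f A K β (f^[j] x) + β * (t - i : ℕ) ≤
      ∑ j ∈ Finset.Ico i t, (Real.log |deriv f (f^[j] x)| - β) := by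
    have : β * (t - i : ℕ) = ∑ j ∈ Finset.Ico i t, β := by simp [mul_comm]
    rw [this, ← Finset.sum_add_distrib]
    refine Finset.sum_le_sum fun j _ => ?_
    unfold hypWeight
    linarith [le_max_left 0 (-(A * Real.log |deriv f (f^[j] x)|) - K)]
  linarith

lemma IsHypTime.sum_penalty_le {f : ℝ → ℝ} {A : ℕ} {K β x : ℝ} {t : ℕ} (hβ : 0 ≤ β)
    (h : IsHypTime f A K β x t) {i : ℕ} (hi : i < t) :
    ∑ j ∈ Finset.Ico i t, max 0 (-(A * Real.log |deriv f (f^[j] x)|) - K) ≤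
      ∑ j ∈ Finset.Ico i t, (Real.log |deriv f (f^[j] x)| - β) := by
  have h1 := h i hi
  rw [← sub_nonneg, ← Finset.sum_sub_distrib]
  refine h1.trans (Finset.sum_le_sum fun j _ => ?_)
  unfold hypWeight
  linarith

lemma IsHypTime.exp_neg_sum_le_pow {f : ℝ → ℝ} {A : ℕ} {K β x : ℝ} {t : ℕ} (hβ : 0 ≤ β)
    (hK : 0 ≤ K) (h : IsHypTime f A K β x t) (h0 : ∀ j, deriv f (f^[j] x) ≠ 0)
    {i : ℕ} (hi : i < t) :
    Real.exp (-∑ j ∈ Finset.Ico i t, (Real.log |deriv f (f^[j] x)| - β))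
      ≤ Real.exp K * min 1 |deriv f (f^[i] x)| ^ A := by
  refine le_trans (Real.exp_le_exp.2 ?_) (exp_neg_penalty_le hK (abs_pos.2 (h0 i)))
  have h1 := h.sum_penalty_le hβ hi
  have h2 := Finset.single_le_sum (s := Finset.Ico i t)
    (f := fun j => max 0 (-(A * Real.log |deriv f (f^[j] x)|) - K))
    (fun _ _ => le_max_left _ _) (Finset.mem_Ico.2 ⟨le_rfl, hi⟩)
  linarith

lemma IsHypTime.exp_neg_sum_le_pow_two {f : ℝ → ℝ} {A : ℕ} {K β M x : ℝ} {t : ℕ} (hβ : 0 ≤ β)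
    (hK : 0 ≤ K) (h : IsHypTime f A K β x t) (h0 : ∀ j, deriv f (f^[j] x) ≠ 0)
    (hM : ∀ j, Real.log |deriv f (f^[j] x)| ≤ M) {i : ℕ} (hi : i + 2 ≤ t) :
    Real.exp (-∑ j ∈ Finset.Ico (i + 2) t, (Real.log |deriv f (f^[j] x)| - β))
      ≤ Real.exp (2 * M + 2 * K) *
        (min 1 |deriv f (f^[i] x)| ^ A * min 1 |deriv f (f^[i + 1] x)| ^ A) := by
  have e1 := exp_neg_penalty_le (A := A) hK (abs_pos.2 (h0 i))
  have e2 := exp_neg_penalty_le (A := A) hK (abs_pos.2 (h0 (i + 1)))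
  have e3 := mul_le_mul e1 e2 (Real.exp_pos _).le (by positivity)
  rw [← Real.exp_add] at e3
  have h1 := h.sum_penalty_le hβ (i := i) (by omega)
  rw [Finset.sum_eq_sum_Ico_succ_bot (by omega : i < t),
    Finset.sum_eq_sum_Ico_succ_bot (by omega : i + 1 < t),
    Finset.sum_eq_sum_Ico_succ_bot (by omega : i < t),
    Finset.sum_eq_sum_Ico_succ_bot (by omega : i + 1 < t)] at h1
  have h2 : 0 ≤ ∑ j ∈ Finset.Ico (i + 1 + 1) t,
      max 0 (-(A * Real.log |deriv f (f^[j] x)|) - K) :=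
    Finset.sum_nonneg fun _ _ => le_max_left _ _
  have hM1 := hM i
  have hM2 := hM (i + 1)
  calc _ ≤ Real.exp (2 * M) * Real.exp (-max 0 (-(A * Real.log |deriv f (f^[i] x)|) - K) +
          -max 0 (-(A * Real.log |deriv f (f^[i + 1] x)|) - K)) := by
        rw [← Real.exp_add]
        exact Real.exp_le_exp.2 (by linarith)
    _ ≤ Real.exp (2 * M) * _ := mul_le_mul_of_nonneg_left e3 (Real.exp_pos _).le
    _ = _ := by
        rw [show 2 * M + 2 * K = 2 * M + K + K by ring, Real.exp_add, Real.exp_add]; ring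

/-- Uniform balls around hyperbolic times can be pulled back with exponential contraction. -/
lemma IsC3NonflatIntervalMap.exists_pullback {f : ℝ → ℝ} {a b : ℝ}
    (hf : IsC3NonflatIntervalMap f a b) {β : ℝ} (hβ : 0 < β) :
    ∃ A : ℕ, ∀ K, 0 ≤ K → ∃ δ > 0, ∀ x ∈ Icc a b, (∀ j, deriv f (f^[j] x) ≠ 0) →
      ∀ s t : ℕ, 2 ≤ s → s ≤ t → IsHypTime f A K β x t →
      ∀ z ∈ Icc a b, |z - f^[t] x| ≤ δ → ∃ w ∈ Icc a b, f^[t - s] w = z ∧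
        ∀ i, s ≤ i → i ≤ t →
          |f^[i - s] w - f^[i] x| ≤ |z - f^[t] x| * Real.exp (-(β * (t - i : ℕ))) := by
  have hdist := hf.distortionOn hβ
  obtain ⟨B, c, hc, hbad⟩ := exists_dist_bad_endpoint hf.lt hf.mapsTo hf.diff hdist
  obtain ⟨A, κ, hκ, M, hκM⟩ := hdist
  have hpow : ∀ (n : ℕ) (d : ℝ), n ≤ max A B → min 1 |d| ^ max A B ≤ min 1 |d| ^ n :=
    fun n d hn => pow_le_pow_of_le_one (by positivity) (min_le_left _ _) hn
  refine ⟨max A B, fun K hK => ⟨min (κ / Real.exp K) (c / 2 / Real.exp (2 * M + 2 * K)),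
    by positivity, fun x hx h0 s t hs hst hyp z hz hzt => ?_⟩⟩
  set δ := min (κ / Real.exp K) (c / 2 / Real.exp (2 * M + 2 * K)) with hδ
  have hδpos : 0 < δ := by positivity
  have hM : ∀ j, Real.log |deriv f (f^[j] x)| ≤ M := fun j =>
    (Real.log_le_self (abs_nonneg _)).trans (hκM _ (hf.mapsTo.iterate j hx)).1
  set R : ℕ → ℝ := fun i =>
    Real.exp (-∑ j ∈ Finset.Ico i t, (Real.log |deriv f (f^[j] x)| - β)) with hR
  obtain ⟨w, hw, hwz, hclose⟩ := _root_.exists_pullback hf.lt hf.mapsTo hf.diff (β := β) (δ := δ)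
    R (by simp [hR]) (fun i => Real.exp_pos _) (fun i hi => by
      simp only [hR]
      rw [Finset.sum_eq_sum_Ico_succ_bot hi]
      nth_rewrite 1 [← Real.exp_log (abs_pos.2 (h0 i))]
      rw [← Real.exp_add, ← Real.exp_add]
      ring_nf) hx s hst (fun i hsi hit => by
      have hend : ∀ e, (e = a ∨ e = b) → |f^[i] x - e| ≤ δ * R i → f e = a ∨ f e = b := by
        intro e he hle
        by_contra hcon
        obtain ⟨k, rfl⟩ : ∃ k, i = k + 2 := ⟨i - 2, by omega⟩
        have e1 := hyp.exp_neg_sum_le_pow_two hβ.le hK h0 hM (i := k) (by omega)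
        have e2 := hbad (f^[k] x) (hf.mapsTo.iterate k hx) (h0 k) (by
          rw [← Function.iterate_succ_apply' f k]; exact h0 (k + 1)) e he hcon
        rw [← Function.iterate_succ_apply' f k, ← Function.iterate_succ_apply' f (k + 1)] at e2
        have d1 := hpow B (deriv f (f^[k] x)) (le_max_right _ _)
        have d2 := hpow B (deriv f (f^[k + 1] x)) (le_max_right _ _)
        have p1 : 0 < min 1 |deriv f (f^[k] x)| ^ B :=
          pow_pos (lt_min one_pos (abs_pos.2 (h0 _))) _
        have p2 : 0 < min 1 |deriv f (f^[k + 1] x)| ^ B :=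
          pow_pos (lt_min one_pos (abs_pos.2 (h0 _))) _
        have : δ * R (k + 2) ≤ c / 2 * (min 1 |deriv f (f^[k] x)| ^ B *
            min 1 |deriv f (f^[k + 1] x)| ^ B) := by
          calc δ * R (k + 2) ≤ c / 2 / Real.exp (2 * M + 2 * K) * (Real.exp (2 * M + 2 * K) *
                (min 1 |deriv f (f^[k] x)| ^ B * min 1 |deriv f (f^[k + 1] x)| ^ B)) := by
                apply mul_le_mul (min_le_right _ _) _ (Real.exp_pos _).le (by positivity)
                refine e1.trans ?_
                gcongr
            _ = _ := by field_simp
        nlinarith [mul_pos hc (mul_pos p1 p2)]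
      refine ⟨h0 i, fun y hy hyx => (hκM _ (hf.mapsTo.iterate i hx)).2 (h0 i) y hy (hyx.trans ?_),
        hend a (Or.inl rfl), hend b (Or.inr rfl)⟩
      calc δ * R i ≤ κ / Real.exp K *
            (Real.exp K * min 1 |deriv f (f^[i] x)| ^ A) := by
            apply mul_le_mul (min_le_left _ _) _ (Real.exp_pos _).le (by positivity)
            refine (hyp.exp_neg_sum_le_pow hβ.le hK h0 hit).trans ?_
            exact mul_le_mul_of_nonneg_left (hpow A _ (le_max_left _ _)) (Real.exp_pos _).le
        _ = _ := by field_simp) hz hzt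
  refine ⟨w, hw, hwz, fun i h1 h2 => (hclose i h1 h2).trans ?_⟩
  gcongr
  exact hyp.exp_neg_sum_le h2

/-- Counting preimages along a chain of sites. At each site `i` there is a set `S i` of points
close to the site and a disjoint set `L i` of points reachable from `S i` by a backward excursion
of length `N`; both can be pulled back from site `i + 1` to `S i`. The weighted number of
backward orbits then grows exponentially with the number of sites. -/
lemma exists_finset_weighted_preimages {X : Type*} (f : X → X) (g : X → ℝ) (x₀ : X)
    (S L : ℕ → Set X) (V : ℕ → X → ℝ) (d : ℕ → ℕ) (T : ℕ → ℝ) (N q : ℕ) (D : ℝ)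
    (hdisj : ∀ i, Disjoint (S i) (L i))
    (hpull : ∀ i < q, ∀ z ∈ S (i + 1) ∪ L (i + 1), ∃ w ∈ S i, f^[d i] w = z ∧
      T i - V (i + 1) z ≤ birkhoffSum f g (d i) w - V i w)
    (hdev : ∀ i ≤ q, ∀ y ∈ S i, ∃ z ∈ L i, f^[N] z = y ∧
      -D - V i y ≤ birkhoffSum f g N z - V i z)
    (hbase : ∃ y ∈ S q, f^[N] y = x₀ ∧ -D ≤ birkhoffSum f g N y - V q y) :
    ∃ Y : Finset (ℕ × X),
      (∀ y ∈ Y, y.2 ∈ S 0 ∧ f^[y.1] y.2 = x₀ ∧ ∑ j ∈ Finset.range q, d j ≤ y.1 ∧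
        y.1 ≤ ∑ j ∈ Finset.range q, d j + (q + 1) * N) ∧
      Real.exp (∑ j ∈ Finset.range q, T j - D) * (1 + Real.exp (-D)) ^ q ≤
        ∑ y ∈ Y, Real.exp (birkhoffSum f g y.1 y.2 - V 0 y.2) := by
  classical
  suffices H : ∀ k i, i + k = q → ∃ Y : Finset (ℕ × X),
      (∀ y ∈ Y, y.2 ∈ S i ∧ f^[y.1] y.2 = x₀ ∧ ∑ j ∈ Finset.Ico i q, d j ≤ y.1 ∧
        y.1 ≤ ∑ j ∈ Finset.Ico i q, d j + (k + 1) * N) ∧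
      Real.exp (∑ j ∈ Finset.Ico i q, T j - D) * (1 + Real.exp (-D)) ^ k ≤
        ∑ y ∈ Y, Real.exp (birkhoffSum f g y.1 y.2 - V i y.2) by
    simpa using H q 0 (zero_add q)
  intro k
  induction k with
  | zero =>
    intro i hi
    obtain rfl : i = q := hi
    obtain ⟨y, hy, hyx, hD⟩ := hbase
    exact ⟨{(N, y)}, by simp [hy, hyx], by simpa using hD⟩
  | succ k ih =>
    intro i hi
    have hiq : i < q := by omega
    obtain ⟨Y, hY, hsum⟩ := ih (i + 1) (by omega)
    have hdev' : ∀ y, ∃ z, y ∈ S (i + 1) → z ∈ L (i + 1) ∧ f^[N] z = y ∧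
        -D - V (i + 1) y ≤ birkhoffSum f g N z - V (i + 1) z := fun y => by
      by_cases hy : y ∈ S (i + 1)
      · obtain ⟨z, h1, h2⟩ := hdev (i + 1) hiq y hy
        exact ⟨z, fun _ => ⟨h1, h2⟩⟩
      · exact ⟨y, fun h => absurd h hy⟩
    choose dev hdevL using hdev'
    have hpull' : ∀ z, ∃ w, z ∈ S (i + 1) ∪ L (i + 1) → w ∈ S i ∧ f^[d i] w = z ∧
        T i - V (i + 1) z ≤ birkhoffSum f g (d i) w - V i w := fun z => by
      by_cases hz : z ∈ S (i + 1) ∪ L (i + 1)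
      · obtain ⟨w, h1, h2⟩ := hpull i hiq z hz
        exact ⟨w, fun _ => ⟨h1, h2⟩⟩
      · exact ⟨z, fun h => absurd h hz⟩
    choose pull hpullS using hpull'
    set Z : Finset (ℕ × X) := Y.image fun y => (y.1 + N, dev y.2) with hZ
    have hZmem : ∀ z ∈ Z, z.2 ∈ L (i + 1) ∧ ∃ y ∈ Y, (y.1 + N, dev y.2) = z := fun z hz => by
      obtain ⟨y, hy, rfl⟩ := Finset.mem_image.1 hz
      exact ⟨(hdevL y.2 (hY y hy).1).1, y, hy, rfl⟩
    have hYZ : Disjoint Y Z := by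
      rw [Finset.disjoint_left]
      intro y hy hz
      exact Set.disjoint_left.1 (hdisj (i + 1)) (hY y hy).1 (hZmem y hz).1
    have hZprop : ∀ z ∈ Y ∪ Z, z.2 ∈ S (i + 1) ∪ L (i + 1) ∧ f^[z.1] z.2 = x₀ ∧
        ∑ j ∈ Finset.Ico (i + 1) q, d j ≤ z.1 ∧
        z.1 ≤ ∑ j ∈ Finset.Ico (i + 1) q, d j + (k + 2) * N := by
      intro z hz
      rcases Finset.mem_union.1 hz with hz | hz
      · obtain ⟨h1, h2, h3, h4⟩ := hY z hz
        exact ⟨Or.inl h1, h2, h3, h4.trans (by gcongr; omega)⟩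
      · obtain ⟨hL, y, hy, rfl⟩ := hZmem z hz
        obtain ⟨h1, h2, h3, h4⟩ := hY y hy
        refine ⟨Or.inr hL, ?_, by simp only; omega, by simp only; nlinarith⟩
        rw [Function.iterate_add_apply, (hdevL y.2 h1).2.1, h2]
    have hZsum : Real.exp (∑ j ∈ Finset.Ico (i + 1) q, T j - D) * (1 + Real.exp (-D)) ^ (k + 1) ≤
        ∑ z ∈ Y ∪ Z, Real.exp (birkhoffSum f g z.1 z.2 - V (i + 1) z.2) := by
      rw [Finset.sum_union hYZ, hZ, Finset.sum_image]
      · have : Real.exp (-D) * ∑ y ∈ Y, Real.exp (birkhoffSum f g y.1 y.2 - V (i + 1) y.2) ≤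
            ∑ y ∈ Y, Real.exp (birkhoffSum f g (y.1 + N) (dev y.2) - V (i + 1) (dev y.2)) := by
          rw [Finset.mul_sum]
          refine Finset.sum_le_sum fun y hy => ?_
          obtain ⟨-, h2, h3⟩ := hdevL y.2 (hY y hy).1
          rw [← Real.exp_add, add_comm y.1, birkhoffSum_add, h2]
          exact Real.exp_le_exp.2 (by linarith)
        rw [pow_succ]
        nlinarith [Real.exp_pos (-D)]
      · intro y hy y' hy' h
        obtain ⟨h1, h2⟩ := Prod.mk.inj h
        refine Prod.ext (by simpa using h1) ?_
        rw [← (hdevL y.2 (hY y hy).1).2.1, ← (hdevL y'.2 (hY y' hy').1).2.1, h2]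
    refine ⟨(Y ∪ Z).image fun z => (z.1 + d i, pull z.2), ?_, ?_⟩
    · intro w hw
      obtain ⟨z, hz, rfl⟩ := Finset.mem_image.1 hw
      obtain ⟨h1, h2, h3, h4⟩ := hZprop z hz
      obtain ⟨p1, p2, p3⟩ := hpullS z.2 h1
      rw [Finset.sum_eq_sum_Ico_succ_bot hiq]
      refine ⟨p1, ?_, by simp only; omega, by simp only; linarith⟩
      rw [Function.iterate_add_apply, p2, h2]
    · rw [Finset.sum_image]
      · have : Real.exp (T i) *
              ∑ z ∈ Y ∪ Z, Real.exp (birkhoffSum f g z.1 z.2 - V (i + 1) z.2) ≤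
            ∑ z ∈ Y ∪ Z, Real.exp (birkhoffSum f g (z.1 + d i) (pull z.2) - V i (pull z.2)) := by
          rw [Finset.mul_sum]
          refine Finset.sum_le_sum fun z hz => ?_
          obtain ⟨-, h2, h3⟩ := hpullS z.2 (hZprop z hz).1
          rw [← Real.exp_add, add_comm z.1, birkhoffSum_add, h2]
          exact Real.exp_le_exp.2 (by linarith)
        refine le_trans ?_ this
        rw [Finset.sum_eq_sum_Ico_succ_bot hiq, add_sub_assoc, Real.exp_add, mul_assoc]
        exact mul_le_mul_of_nonneg_left hZsum (Real.exp_pos _).le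
      · intro y hy y' hy' h
        obtain ⟨h1, h2⟩ := Prod.mk.inj h
        refine Prod.ext (by simpa using h1) ?_
        rw [← (hpullS y.2 (hZprop y hy).1).2.1, ← (hpullS y'.2 (hZprop y' hy').1).2.1, h2]

lemma HolderOn.exists_abs_le {φ : ℝ → ℝ} {a b : ℝ} (hφ : HolderOn φ (Icc a b)) :
    ∃ B, 0 ≤ B ∧ ∀ x ∈ Icc a b, |φ x| ≤ B := by
  obtain ⟨C, α, hα, -, hC, h⟩ := hφ
  refine ⟨|φ a| + C * |b - a| ^ α, by positivity, fun x hx => ?_⟩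
  have ha : a ∈ Icc a b := ⟨le_rfl, hx.1.trans hx.2⟩
  have h1 := h x hx a ha
  have h2 : |x - a| ^ α ≤ |b - a| ^ α := by
    apply Real.rpow_le_rpow (abs_nonneg _) _ hα.le
    rw [abs_of_nonneg (by linarith [hx.1]), abs_of_nonneg (by linarith [hx.1, hx.2])]
    linarith [hx.2]
  have h3 := mul_le_mul_of_nonneg_left h2 hC
  have h4 := abs_sub_abs_le_abs_sub (φ x) (φ a)
  linarith

/-- Hölder functions have uniformly bounded distortion along exponentially contracted orbits. -/
lemma sum_sub_le_of_contracted {φ : ℝ → ℝ} {I : Set ℝ} {C α β r : ℝ} (hC : 0 ≤ C) (hα : 0 < α)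
    (hβ : 0 < β) (hr : 0 ≤ r) (h : ∀ x ∈ I, ∀ y ∈ I, |φ x - φ y| ≤ C * |x - y| ^ α)
    (u v : ℕ → ℝ) (n : ℕ) (hu : ∀ j < n, u j ∈ I) (hv : ∀ j < n, v j ∈ I)
    (huv : ∀ j < n, |u j - v j| ≤ r * Real.exp (-(β * (n - j : ℕ)))) :
    ∑ j ∈ Finset.range n, φ (v j) - C / (1 - Real.exp (-(β * α))) * r ^ α ≤
      ∑ j ∈ Finset.range n, φ (u j) := by
  set ρ := Real.exp (-(β * α)) with hρ
  have hρ1 : ρ < 1 := Real.exp_lt_one_iff.2 (by nlinarith)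
  have hρ0 : 0 < ρ := Real.exp_pos _
  have h1 : ∀ j ∈ Finset.range n, φ (v j) - φ (u j) ≤ C * r ^ α * ρ ^ (n - 1 - j) := by
    intro j hj
    have hj := Finset.mem_range.1 hj
    have h2 := (le_abs_self _).trans (h (v j) (hv j hj) (u j) (hu j hj))
    rw [abs_sub_comm] at h2
    refine h2.trans ?_
    rw [mul_assoc]
    refine mul_le_mul_of_nonneg_left ?_ hC
    refine (Real.rpow_le_rpow (abs_nonneg _) (huv j hj) hα.le).trans ?_
    rw [Real.mul_rpow hr (Real.exp_pos _).le]
    refine mul_le_mul_of_nonneg_left ?_ (Real.rpow_nonneg hr _)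
    rw [← Real.exp_mul, hρ, ← Real.exp_nat_mul]
    apply Real.exp_le_exp.2
    have h3 : ((n - 1 - j : ℕ) : ℝ) ≤ ((n - j : ℕ) : ℝ) := by exact_mod_cast by omega
    nlinarith [mul_le_mul_of_nonneg_left h3 (mul_pos hβ hα).le]
  have h2 := Finset.sum_le_sum h1
  rw [Finset.sum_sub_distrib, ← Finset.mul_sum, Finset.sum_range_reflect (fun j => ρ ^ j)] at h2
  have h3 : ∑ j ∈ Finset.range n, ρ ^ j ≤ 1 / (1 - ρ) := by
    rw [le_div_iff₀ (by linarith), geom_sum_mul_neg]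
    linarith [pow_pos hρ0 n]
  have h4 := mul_le_mul_of_nonneg_left h3 (mul_nonneg hC (Real.rpow_nonneg hr α))
  have h5 : C / (1 - ρ) * r ^ α = C * r ^ α * (1 / (1 - ρ)) := by ring
  linarith

/-- Along an orbit with `q + 1` well-separated hyperbolic times, the weighted number of backward
orbits of any point exceeds the Birkhoff weight of the orbit by a factor exponential in `q`. -/
lemma exists_finset_preimages_of_isHypTime {f φ : ℝ → ℝ} {a b : ℝ}
    (hf : IsC3NonflatIntervalMap f a b) (hex : TopExact f (Icc a b)) (hφ : HolderOn φ (Icc a b))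
    {β : ℝ} (hβ : 0 < β) {G : ℕ} (hG1 : 1 ≤ G) (hG : Real.exp (-(β * G)) ≤ 1 / 8)
    (B' : ℝ) {P : ℝ → ℕ → Prop} {δ₀ : ℝ} (hδ₀ : 0 < δ₀)
    (hpb : ∀ x ∈ Icc a b, ∀ s t : ℕ, s ≤ t → P x s → P x t →
      ∀ z ∈ Icc a b, |z - f^[t] x| ≤ δ₀ → ∃ w ∈ Icc a b, f^[t - s] w = z ∧
        ∀ i, s ≤ i → i ≤ t →
          |f^[i - s] w - f^[i] x| ≤ |z - f^[t] x| * Real.exp (-(β * (t - i : ℕ)))) :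
    ∃ N : ℕ, ∃ D : ℝ, 0 ≤ D ∧ ∀ m, |m| ≤ B' → ∀ x ∈ Icc a b, ∀ (q : ℕ) (h : ℕ → ℕ),
      (∀ i < q, h i + G ≤ h (i + 1)) → (∀ i ≤ q, P x (h i)) → ∀ x₀ ∈ Icc a b,
      ∃ Y : Finset (ℕ × ℝ), (∀ y ∈ Y, y.2 ∈ Icc a b ∧ f^[y.1] y.2 = x₀ ∧ h q ≤ h 0 + y.1 ∧
          y.1 ≤ h q - h 0 + (q + 1) * N) ∧
        Real.exp (∑ j ∈ Finset.Ico (h 0) (h q), (φ (f^[j] x) - m) - D) *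
          (1 + Real.exp (-D)) ^ q ≤
        ∑ y ∈ Y, Real.exp (birkhoffSum f (fun x => φ x - m) y.1 y.2) := by
  obtain ⟨B, hB, hφB⟩ := hφ.exists_abs_le
  obtain ⟨C, α, hα, -, hC, hHol⟩ := hφ
  have hab := hf.lt
  have hm := hf.mapsTo
  set δ := min δ₀ (b - a) with hδ
  have hδ0 : 0 < δ := lt_min hδ₀ (by linarith)
  have hδab : δ ≤ b - a := min_le_right _ _
  obtain ⟨N, hN⟩ := hex.exists_uniform hab hm (δ := δ / 8) (by linarith)
  set ρ := Real.exp (-(β * α)) with hρ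
  have hρ1 : ρ < 1 := Real.exp_lt_one_iff.2 (by nlinarith)
  set C₁ := C / (1 - ρ) with hC₁
  set E := C₁ / (1 - ρ) with hE
  have hC₁0 : 0 ≤ C₁ := div_nonneg hC (by linarith)
  have hE0 : 0 ≤ E := div_nonneg hC₁0 (by linarith)
  have hEeq : C₁ + E * ρ = E := by
    have : E * (1 - ρ) = C₁ := div_mul_cancel₀ _ (by linarith)
    linarith
  refine ⟨N, N * (B + |B'|) + E * δ ^ α, by positivity, fun m hmB x hx q h hsep hP x₀ hx₀ => ?_⟩
  set D := N * (B + |B'|) + E * δ ^ α with hD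
  have hX : ∀ j, f^[j] x ∈ Icc a b := fun j => hm.iterate j hx
  have hbirk : ∀ z ∈ Icc a b, -(N * (B + |B'|)) ≤ birkhoffSum f (fun x => φ x - m) N z := by
    intro z hz
    have : ∑ j ∈ Finset.range N, (-(B + |B'|)) ≤
        ∑ j ∈ Finset.range N, (φ (f^[j] z) - m) := by
      refine Finset.sum_le_sum fun j _ => ?_
      have h1 := (abs_le.1 (hφB _ (hm.iterate j hz))).1
      have h2 := (abs_le.1 hmB).2
      linarith [le_abs_self B']
    rw [Finset.sum_const, Finset.card_range, nsmul_eq_mul] at this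
    simp only [birkhoffSum]
    linarith
  have hV : ∀ z i, |z - f^[h i] x| ≤ δ → E * |z - f^[h i] x| ^ α ≤ E * δ ^ α := fun z i hz =>
    mul_le_mul_of_nonneg_left (Real.rpow_le_rpow (abs_nonneg _) hz hα.le) hE0
  have hmono : ∀ k ≤ q, h 0 ≤ h k ∧ ∑ j ∈ Finset.range k, (h (j + 1) - h j) = h k - h 0 ∧
      ∑ i ∈ Finset.range k, ∑ j ∈ Finset.Ico (h i) (h (i + 1)), (φ (f^[j] x) - m) =
        ∑ j ∈ Finset.Ico (h 0) (h k), (φ (f^[j] x) - m) := by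
    intro k
    induction k with
    | zero => simp
    | succ k ih =>
      intro hk
      obtain ⟨h1, h2, h3⟩ := ih (by omega)
      have h4 := hsep k (by omega)
      refine ⟨by omega, ?_, ?_⟩
      · rw [Finset.sum_range_succ, h2]; omega
      · rw [Finset.sum_range_succ, h3, Finset.sum_Ico_consecutive _ h1 (by omega)]
  have hex_Y := exists_finset_weighted_preimages f (fun x => φ x - m) x₀
    (fun i => {y | y ∈ Icc a b ∧ |y - f^[h i] x| ≤ δ / 8})
    (fun i => {y | y ∈ Icc a b ∧ δ / 8 < |y - f^[h i] x| ∧ |y - f^[h i] x| ≤ δ})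
    (fun i y => E * |y - f^[h i] x| ^ α) (fun i => h (i + 1) - h i)
    (fun i => ∑ j ∈ Finset.Ico (h i) (h (i + 1)), (φ (f^[j] x) - m)) N q D
    (fun i => Set.disjoint_left.2 fun y h1 h2 => absurd h1.2 (not_le.2 h2.2.1)) ?_ ?_ ?_
  rotate_left
  · intro i hi z hz
    have hzI : z ∈ Icc a b ∧ |z - f^[h (i + 1)] x| ≤ δ := by
      rcases hz with hz | hz
      · exact ⟨hz.1, hz.2.trans (by linarith)⟩
      · exact ⟨hz.1, hz.2.2⟩
    have hle : h i + G ≤ h (i + 1) := hsep i hi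
    obtain ⟨w, hw, hwz, hclose⟩ := hpb x hx (h i) (h (i + 1)) (by omega) (hP i hi.le)
      (hP (i + 1) hi) z hzI.1 (hzI.2.trans (min_le_left _ _))
    set r := |z - f^[h (i + 1)] x| with hr
    have hr0 : 0 ≤ r := abs_nonneg _
    have hw0 := hclose (h i) le_rfl (by omega)
    rw [Nat.sub_self, Function.iterate_zero, id] at hw0
    have hGd : (G : ℝ) ≤ ((h (i + 1) - h i : ℕ) : ℝ) := by exact_mod_cast by omega
    have hexpd : Real.exp (-(β * (h (i + 1) - h i : ℕ))) ≤ Real.exp (-(β * G)) :=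
      Real.exp_le_exp.2 (by nlinarith)
    refine ⟨w, ⟨hw, ?_⟩, hwz, ?_⟩
    · have := mul_le_mul hzI.2 (hexpd.trans hG) (Real.exp_pos _).le hδ0.le
      linarith
    · have hdist := sum_sub_le_of_contracted (φ := fun x => φ x - m) (I := Icc a b) hC hα hβ hr0
        (fun x hx y hy => by simpa using hHol x hx y hy)
        (fun j => f^[j] w) (fun j => f^[h i + j] x) (h (i + 1) - h i)
        (fun j _ => hm.iterate j hw) (fun j _ => hX _) (fun j hj => by
          have := hclose (h i + j) (by omega) (by omega)
          rwa [Nat.add_sub_cancel_left, show h (i + 1) - (h i + j) = h (i + 1) - h i - j by omega]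
            at this)
      have hT : ∑ j ∈ Finset.Ico (h i) (h (i + 1)), (φ (f^[j] x) - m) =
          ∑ j ∈ Finset.range (h (i + 1) - h i), (φ (f^[h i + j] x) - m) :=
        Finset.sum_Ico_eq_sum_range _ _ _
      have hwV : E * |w - f^[h i] x| ^ α ≤ E * ρ * r ^ α := by
        rw [mul_assoc]
        refine mul_le_mul_of_nonneg_left ?_ hE0
        refine (Real.rpow_le_rpow (abs_nonneg _) hw0 hα.le).trans ?_
        rw [Real.mul_rpow hr0 (Real.exp_pos _).le, mul_comm]
        refine mul_le_mul_of_nonneg_right ?_ (Real.rpow_nonneg hr0 _)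
        rw [← Real.exp_mul, hρ]
        apply Real.exp_le_exp.2
        have : (1 : ℝ) ≤ ((h (i + 1) - h i : ℕ) : ℝ) := by exact_mod_cast by omega
        nlinarith [mul_pos hβ hα]
      simp only [birkhoffSum]
      rw [hT]
      have : E * r ^ α = C₁ * r ^ α + E * ρ * r ^ α := by rw [← add_mul, hEeq]
      linarith
  · intro i _ y hy
    obtain ⟨u, v, hu, hv, huv, hzz⟩ : ∃ u v, a ≤ u ∧ v ≤ b ∧ u + δ / 8 ≤ v ∧
        ∀ z ∈ Icc u v, δ / 8 < |z - f^[h i] x| ∧ |z - f^[h i] x| ≤ δ := by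
      obtain ⟨h1, h2⟩ := hX (h i)
      rcases le_total (f^[h i] x + δ / 2) b with h3 | h3
      · refine ⟨f^[h i] x + δ / 4, f^[h i] x + δ / 2, by linarith, h3, by linarith,
          fun z hz => ?_⟩
        rw [abs_of_nonneg (by linarith [hz.1])]
        constructor <;> linarith [hz.1, hz.2]
      · refine ⟨f^[h i] x - δ / 2, f^[h i] x - δ / 4, by linarith, by linarith, by linarith,
          fun z hz => ?_⟩
        rw [abs_of_nonpos (by linarith [hz.2])]
        constructor <;> linarith [hz.1, hz.2]
    obtain ⟨z, hz, hzy⟩ := hN u v hu hv huv N le_rfl y hy.1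
    have hzI : z ∈ Icc a b := ⟨hu.trans hz.1, hz.2.trans hv⟩
    refine ⟨z, ⟨hzI, hzz z hz⟩, hzy, ?_⟩
    have h1 := hbirk z hzI
    have h2 := hV z i (hzz z hz).2
    have h3 : 0 ≤ E * |y - f^[h i] x| ^ α := by positivity
    linarith
  · obtain ⟨u, v, hu, hv, huv, hzz⟩ : ∃ u v, a ≤ u ∧ v ≤ b ∧ u + δ / 8 ≤ v ∧
        ∀ z ∈ Icc u v, |z - f^[h q] x| ≤ δ / 8 := by
      obtain ⟨h1, h2⟩ := hX (h q)
      rcases le_total (f^[h q] x + δ / 8) b with h3 | h3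
      · refine ⟨f^[h q] x, f^[h q] x + δ / 8, by linarith, h3, by linarith, fun z hz => ?_⟩
        rw [abs_of_nonneg (by linarith [hz.1])]
        linarith [hz.1, hz.2]
      · refine ⟨f^[h q] x - δ / 8, f^[h q] x, by linarith, by linarith, by linarith,
          fun z hz => ?_⟩
        rw [abs_of_nonpos (by linarith [hz.2])]
        linarith [hz.1, hz.2]
    obtain ⟨z, hz, hzy⟩ := hN u v hu hv huv N le_rfl x₀ hx₀
    have hzI : z ∈ Icc a b := ⟨hu.trans hz.1, hz.2.trans hv⟩
    refine ⟨z, ⟨hzI, hzz z hz⟩, hzy, ?_⟩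
    have h1 := hbirk z hzI
    have h2 := hV z q ((hzz z hz).trans (by linarith))
    linarith
  obtain ⟨Y, hY, hsum⟩ := hex_Y
  obtain ⟨h1, h2, h3⟩ := hmono q le_rfl
  refine ⟨Y, fun y hy => ?_, ?_⟩
  · obtain ⟨p1, p2, p3, p4⟩ := hY y hy
    rw [h2] at p3 p4
    exact ⟨p1.1, p2, by omega, p4⟩
  · rw [h3] at hsum
    refine hsum.trans (Finset.sum_le_sum fun y _ => Real.exp_le_exp.2 ?_)
    have : 0 ≤ E * |y.2 - f^[h 0] x| ^ α := by positivity
    linarith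

/-- Pliss-type lemma: the times at which all backward sums of a sequence bounded above by `M` are
nonnegative are at least as frequent as the ratio of the total sum to `M`. -/
lemma sum_range_le_mul_card_filter (g : ℕ → ℝ) {M : ℝ} (hM : 0 ≤ M) (hg : ∀ j, g j ≤ M)
    (p : ℕ → Prop) [DecidablePred p] (hp : ∀ t, p t ↔ ∀ i < t, 0 ≤ ∑ j ∈ Finset.Ico i t, g j)
    (n : ℕ) : ∀ t ≤ n, ∑ j ∈ Finset.range t, g j ≤ M * ((Finset.Icc 1 n).filter p).card := by
  induction n with
  | zero =>
    intro t ht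
    obtain rfl : t = 0 := by omega
    simp
  | succ n ih =>
    have hmono : ((Finset.Icc 1 n).filter p).card ≤ ((Finset.Icc 1 (n + 1)).filter p).card :=
      Finset.card_le_card (Finset.filter_subset_filter _ (Finset.Icc_subset_Icc_right (by omega)))
    have hmono' : M * ((Finset.Icc 1 n).filter p).card ≤
        M * ((Finset.Icc 1 (n + 1)).filter p).card :=
      mul_le_mul_of_nonneg_left (by exact_mod_cast hmono) hM
    intro t ht
    rcases Nat.lt_or_ge n t with hnt | hnt
    · obtain rfl : t = n + 1 := by omega
      by_cases hpn : p (n + 1)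
      · have hcard : ((Finset.Icc 1 (n + 1)).filter p).card =
            ((Finset.Icc 1 n).filter p).card + 1 := by
          rw [← Finset.insert_Icc_right_eq_Icc_add_one (by omega), Finset.filter_insert,
            if_pos hpn, Finset.card_insert_of_notMem (by simp)]
        rw [Finset.sum_range_succ, hcard]
        push_cast
        linarith [ih n le_rfl, hg n]
      · rw [hp] at hpn
        push Not at hpn
        obtain ⟨i, hi, hlt⟩ := hpn
        rw [Finset.sum_Ico_eq_sub _ hi.le] at hlt
        linarith [ih i (by omega)]
    · exact (ih t hnt).trans hmono'

lemma Nat.nth_add_le_nth {p : ℕ → Prop} (hp : (Set.ofPred p).Finite) (i k : ℕ)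
    (h : i + k < hp.toFinset.card) : Nat.nth p i + k ≤ Nat.nth p (i + k) := by
  induction k with
  | zero => simp
  | succ k ih =>
    have h1 := ih (by omega)
    have h2 := Nat.nth_strictMonoOn hp (a := i + k) (b := i + (k + 1))
      (Set.mem_Iio.2 (by omega)) (Set.mem_Iio.2 h) (by omega)
    omega

/-- Well-separated hyperbolic times occur with positive frequency. -/
lemma exists_separated_times (g : ℕ → ℝ) {M : ℝ} (hM : 0 < M) (hg : ∀ j, g j ≤ M) {G : ℕ}
    (hG : 1 ≤ G) {n : ℕ} (hS : M < ∑ j ∈ Finset.range n, g j) :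
    ∃ (q : ℕ) (h : ℕ → ℕ), (∀ i < q, h i + G ≤ h (i + 1)) ∧
      (∀ i ≤ q, 2 ≤ h i ∧ h i ≤ n ∧ ∀ k < h i, 0 ≤ ∑ j ∈ Finset.Ico k (h i), g j) ∧
      ∑ j ∈ Finset.range n, g j ≤ M * ((q + 1) * G + 1) := by
  classical
  set p : ℕ → Prop := fun t => ∀ i < t, 0 ≤ ∑ j ∈ Finset.Ico i t, g j with hp
  have hcard := sum_range_le_mul_card_filter g hM.le hg p (fun t => Iff.rfl) n n le_rfl
  set R := (Finset.Icc 1 n).filter p with hR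
  have hRe : R.card ≤ (R.erase 1).card + 1 := by
    have := Finset.pred_card_le_card_erase (s := R) (a := 1)
    omega
  set r := (R.erase 1).card with hr
  have hr1 : 1 ≤ r := by
    have h1 : M * 1 < M * R.card := by linarith
    have h2 : (1 : ℝ) < R.card := lt_of_mul_lt_mul_left h1 hM.le
    have h3 : 1 < R.card := by exact_mod_cast h2
    omega
  have hfin : (Set.ofPred fun t => t ∈ R.erase 1).Finite := (R.erase 1).finite_toSet
  have hfc : hfin.toFinset.card = r := by
    rw [hr]; congr 1; ext t; exact hfin.mem_toFinset
  have hqG : (r - 1) / G * G ≤ r - 1 := Nat.div_mul_le_self _ _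
  have hqG' : r ≤ ((r - 1) / G + 1) * G := by
    have := Nat.lt_div_mul_add (a := r - 1) (b := G) (by omega)
    rw [add_mul, one_mul]
    omega
  refine ⟨(r - 1) / G, fun i => Nat.nth (fun t => t ∈ R.erase 1) (i * G), fun i hi => ?_,
    fun i hi => ?_, ?_⟩
  · have h1 : (i + 1) * G ≤ (r - 1) / G * G := Nat.mul_le_mul_right _ hi
    have h2 := Nat.nth_add_le_nth hfin (i * G) G (by rw [hfc]; rw [add_mul] at h1; omega)
    simp only [add_mul, one_mul]
    exact h2
  · have h1 : i * G ≤ (r - 1) / G * G := Nat.mul_le_mul_right _ hi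
    have h2 := Nat.nth_mem_of_lt_card hfin (n := i * G) (by rw [hfc]; omega)
    obtain ⟨h3, h4⟩ := Finset.mem_erase.1 h2
    obtain ⟨h5, h6⟩ := Finset.mem_filter.1 h4
    obtain ⟨h7, h8⟩ := Finset.mem_Icc.1 h5
    exact ⟨(Nat.lt_of_le_of_ne h7 (Ne.symm h3) :), h8, h6⟩
  · refine hcard.trans (mul_le_mul_of_nonneg_left ?_ hM.le)
    have : R.card ≤ ((r - 1) / G + 1) * G + 1 := by omega
    exact_mod_cast this

/-- By Rolle's theorem, the number of `n`-th preimages of a point is at most exponential in `n`. -/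
lemma IsC3NonflatIntervalMap.exists_card_le {f : ℝ → ℝ} {a b : ℝ}
    (hf : IsC3NonflatIntervalMap f a b) :
    ∃ Q : ℕ, 1 ≤ Q ∧ ∀ (n : ℕ) (y : ℝ) (s : Finset ℝ),
      (∀ x ∈ s, x ∈ Icc a b ∧ f^[n] x = y) → s.card ≤ Q ^ n := by
  set t := hf.critFinite.toFinset with ht
  refine ⟨t.card + 1, by omega, fun n => ?_⟩
  have hone : ∀ (y : ℝ) (s : Finset ℝ), (∀ x ∈ s, x ∈ Icc a b ∧ f x = y) →
      s.card ≤ t.card + 1 := by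
    intro y s hs
    refine Finset.card_le_of_interleaved fun u hu v hv huv _ => ?_
    obtain ⟨huI, hfu⟩ := hs u hu
    obtain ⟨hvI, hfv⟩ := hs v hv
    have hsub : Icc u v ⊆ Icc a b := Icc_subset_Icc huI.1 hvI.2
    obtain ⟨c, hc, hc'⟩ := exists_deriv_eq_zero huv
      (fun x hx => (hf.diff x (hsub hx)).continuousAt.continuousWithinAt) (hfu.trans hfv.symm)
    exact ⟨c, hf.critFinite.mem_toFinset.2 ⟨hsub (Ioo_subset_Icc_self hc), hc'⟩, hc.1, hc.2⟩
  induction n with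
  | zero =>
    intro y s hs
    rw [pow_zero]
    refine Finset.card_le_one.2 fun u hu v hv => ?_
    have h1 := (hs u hu).2
    have h2 := (hs v hv).2
    exact h1.trans h2.symm
  | succ n ih =>
    intro y s hs
    classical
    have h1 : (s.image f).card ≤ (t.card + 1) ^ n := ih y _ fun x hx => by
      obtain ⟨w, hw, rfl⟩ := Finset.mem_image.1 hx
      obtain ⟨h1, h2⟩ := hs w hw
      exact ⟨hf.mapsTo h1, by rwa [Function.iterate_succ_apply] at h2⟩
    have h2 := Finset.card_le_mul_card_image (f := f) s (t.card + 1) fun z _ =>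
      hone z (s.filter fun x => f x = z) fun x hx => by
        obtain ⟨h1, h2⟩ := Finset.mem_filter.1 hx
        exact ⟨(hs x h1).1, h2⟩
    rw [pow_succ, mul_comm]
    exact h2.trans (Nat.mul_le_mul_left _ h1)

lemma IsC3NonflatIntervalMap.finite_preimages {f : ℝ → ℝ} {a b : ℝ}
    (hf : IsC3NonflatIntervalMap f a b) (n : ℕ) (y : ℝ) :
    {x | x ∈ Icc a b ∧ f^[n] x = y}.Finite := by
  obtain ⟨Q, -, hQ⟩ := hf.exists_card_le
  by_contra hinf
  obtain ⟨s, hs, hcard⟩ := Set.Infinite.exists_subset_card_eq hinf (Q ^ n + 1)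
  have := hQ n y s fun x hx => hs hx
  omega

lemma IsC3NonflatIntervalMap.sum_le_preimSum {f : ℝ → ℝ} {a b : ℝ}
    (hf : IsC3NonflatIntervalMap f a b) (φ : ℝ → ℝ) (n : ℕ) (y : ℝ) (s : Finset ℝ)
    (hs : ∀ x ∈ s, x ∈ Icc a b ∧ f^[n] x = y) :
    ∑ x ∈ s, Real.exp (birkhoffSum f φ n x) ≤ preimSum f φ (Icc a b) n y := by
  rw [preimSum, finsum_mem_eq_finite_toFinset_sum _ (hf.finite_preimages n y)]
  exact Finset.sum_le_sum_of_subset_of_nonneg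
    (fun x hx => (hf.finite_preimages n y).mem_toFinset.2 (hs x hx))
    fun _ _ _ => (Real.exp_pos _).le

/-- Exponential lower bounds along a subsequence bound the growth rate of `preimSum`. -/
lemma IsC3NonflatIntervalMap.le_limsup_preimSum {f : ℝ → ℝ} {a b : ℝ}
    (hf : IsC3NonflatIntervalMap f a b) {φ : ℝ → ℝ} (hφ : HolderOn φ (Icc a b)) {c y : ℝ}
    (h : ∃ᶠ n : ℕ in atTop, Real.exp (n * c) ≤ preimSum f φ (Icc a b) n y)
    (hpos : ∀ n : ℕ, ∃ x ∈ Icc a b, f^[n] x = y) :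
    c ≤ atTop.limsup (fun n : ℕ => Real.log (preimSum f φ (Icc a b) n y) / n) := by
  obtain ⟨Q, hQ1, hQ⟩ := hf.exists_card_le
  obtain ⟨B, hB, hφB⟩ := hφ.exists_abs_le
  have hup : ∀ n : ℕ, preimSum f φ (Icc a b) n y ≤ Real.exp (n * (Real.log Q + B)) := by
    intro n
    rw [preimSum, finsum_mem_eq_finite_toFinset_sum _ (hf.finite_preimages n y)]
    have h1 : ∀ x ∈ (hf.finite_preimages n y).toFinset,
        Real.exp (birkhoffSum f φ n x) ≤ Real.exp (n * B) := by
      intro x hx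
      have hx := (hf.finite_preimages n y).mem_toFinset.1 hx
      apply Real.exp_le_exp.2
      have : ∑ j ∈ Finset.range n, φ (f^[j] x) ≤ ∑ j ∈ Finset.range n, B :=
        Finset.sum_le_sum fun j _ => (le_abs_self _).trans (hφB _ (hf.mapsTo.iterate j hx.1))
      simpa [birkhoffSum] using this
    refine (Finset.sum_le_card_nsmul _ _ _ h1).trans ?_
    have h2 := hQ n y (hf.finite_preimages n y).toFinset
      fun x hx => (hf.finite_preimages n y).mem_toFinset.1 hx
    have hQ0 : (0 : ℝ) < Q := by exact_mod_cast hQ1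
    rw [nsmul_eq_mul, mul_add, Real.exp_add, Real.exp_nat_mul (Real.log Q) n, Real.exp_log hQ0]
    refine mul_le_mul_of_nonneg_right ?_ (Real.exp_pos _).le
    exact_mod_cast h2
  have hpos' : ∀ n : ℕ, 0 < preimSum f φ (Icc a b) n y := by
    intro n
    obtain ⟨x, hx, hxy⟩ := hpos n
    refine lt_of_lt_of_le ?_ (hf.sum_le_preimSum φ n y {x} (by simp [hx.1, hx.2, hxy]))
    simpa using Real.exp_pos _
  refine le_limsup_of_frequently_le ?_ ?_
  · refine (h.and_eventually (eventually_gt_atTop 0)).mono fun n hn => ?_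
    rw [le_div_iff₀ (by exact_mod_cast hn.2), Real.le_log_iff_exp_le (hpos' n), mul_comm]
    exact hn.1
  · refine isBoundedUnder_of_eventually_le (a := Real.log Q + B) ?_
    filter_upwards [eventually_gt_atTop 0] with n hn
    rw [div_le_iff₀ (by exact_mod_cast hn), Real.log_le_iff_le_exp (hpos' n), mul_comm]
    exact hup n

lemma HolderOn.exists_dist_le {φ : ℝ → ℝ} {I : Set ℝ} (hφ : HolderOn φ I) {c : ℝ} (hc : 0 < c) :
    ∃ ε > 0, ∀ x ∈ I, ∀ y ∈ I, |x - y| ≤ ε → |φ x - φ y| ≤ c := by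
  obtain ⟨C, α, hα, -, hC, h⟩ := hφ
  refine ⟨(c / (C + 1)) ^ (1 / α), by positivity, fun x hx y hy hxy => (h x hx y hy).trans ?_⟩
  have h1 := Real.rpow_le_rpow (abs_nonneg _) hxy hα.le
  rw [← Real.rpow_mul (by positivity), one_div_mul_cancel hα.ne', Real.rpow_one,
    le_div_iff₀ (by linarith)] at h1
  nlinarith [Real.rpow_nonneg (abs_nonneg (x - y)) α]

/-- If Birkhoff averages exceed `m + c` along arbitrarily long orbit segments, then so does the
growth rate of the weighted preimage sums. -/
lemma lt_limsup_of_frequently_large {f φ : ℝ → ℝ} {a b : ℝ}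
    (hf : IsC3NonflatIntervalMap f a b) (hex : TopExact f (Icc a b)) (hφ : HolderOn φ (Icc a b))
    {m c y : ℝ} (hc : 0 < c) (hy : y ∈ Icc a b)
    (h : ∃ᶠ n : ℕ in atTop, ∃ x ∈ Icc a b, n * (m + c) ≤ birkhoffSum f φ n x) :
    m < atTop.limsup (fun n : ℕ => Real.log (preimSum f φ (Icc a b) n y) / n) := by
  obtain ⟨B, hB, hφB⟩ := hφ.exists_abs_le
  obtain ⟨ε, hε, hosc⟩ := hφ.exists_dist_le (c := c / 2) (by linarith)
  obtain ⟨N, hN⟩ := hex.exists_shadow hf.lt hf.mapsTo hf.continuousOn hε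
  refine lt_of_lt_of_le (by linarith : m < m + c / 4) (hf.le_limsup_preimSum hφ ?_
    fun n => hex.exists_preimage_iterate hf.lt hf.mapsTo n y hy)
  rw [frequently_atTop] at h ⊢
  intro n₀
  obtain ⟨k, hk⟩ := exists_nat_ge (N * (B + m + c / 4) / (c / 4))
  rw [div_le_iff₀ (by linarith)] at hk
  obtain ⟨n, hn, x, hx, hsum⟩ := h (max n₀ k)
  obtain ⟨w, hw, hwy, hclose⟩ := hN x hx n y hy
  refine ⟨N + n, by have := le_max_left n₀ k; omega, ?_⟩
  have hle := hf.sum_le_preimSum φ (N + n) y {w} (by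
    simp only [Finset.mem_singleton, forall_eq]
    exact ⟨hw, by rw [Function.iterate_add_apply, hwy]⟩)
  rw [Finset.sum_singleton] at hle
  refine le_trans (Real.exp_le_exp.2 ?_) hle
  rw [add_comm N n, birkhoffSum_add]
  have h1 : birkhoffSum f φ n x - n * (c / 2) ≤ birkhoffSum f φ n w := by
    simp only [birkhoffSum]
    have : (n : ℝ) * (c / 2) = ∑ j ∈ Finset.range n, c / 2 := by simp
    rw [this, ← Finset.sum_sub_distrib]
    refine Finset.sum_le_sum fun j hj => ?_
    have := hosc _ (hf.mapsTo.iterate j hw) _ (hf.mapsTo.iterate j hx)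
      (hclose j (Finset.mem_range.1 hj).le)
    linarith [(abs_le.1 this).1]
  have h2 : -(N * B) ≤ birkhoffSum f φ N (f^[n] w) := by
    simp only [birkhoffSum]
    have : -((N : ℝ) * B) = ∑ j ∈ Finset.range N, -B := by simp
    rw [this]
    exact Finset.sum_le_sum fun j _ =>
      (abs_le.1 (hφB _ (hf.mapsTo.iterate j (hf.mapsTo.iterate n hw)))).1
  have hkn : (k : ℝ) ≤ n := by exact_mod_cast (le_max_right n₀ k).trans hn
  push_cast
  nlinarith

lemma IsC3NonflatIntervalMap.exists_hypWeight_le {f : ℝ → ℝ} {a b : ℝ}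
    (hf : IsC3NonflatIntervalMap f a b) (A : ℕ) (K : ℝ) {β : ℝ} (hβ : 0 < β) :
    ∃ M > 0, ∀ x ∈ Icc a b, hypWeight f A K β x ≤ M := by
  obtain ⟨_, _, _, M, hM⟩ := hf.distortionOn hβ
  refine ⟨max M 1, by positivity, fun x hx => ?_⟩
  have h1 := (Real.log_le_self (abs_nonneg _)).trans (hM x hx).1
  unfold hypWeight
  linarith [le_max_left 0 (-(A * Real.log |deriv f x|) - K), le_max_left M 1]

lemma IsC3NonflatIntervalMap.sum_exp_birkhoffSum_le {f : ℝ → ℝ} {a b : ℝ}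
    (hf : IsC3NonflatIntervalMap f a b) {φ : ℝ → ℝ} {m x₀ : ℝ} {L : ℕ} (Y : Finset (ℕ × ℝ))
    (hY : ∀ y ∈ Y, y.2 ∈ Icc a b ∧ f^[y.1] y.2 = x₀ ∧ y.1 < L ∧
      preimSum f φ (Icc a b) y.1 x₀ ≤ Real.exp (y.1 * m)) :
    ∑ y ∈ Y, Real.exp (birkhoffSum f (fun x => φ x - m) y.1 y.2) ≤ L := by
  classical
  rw [← Finset.sum_fiberwise_of_maps_to (s := Y) (t := Finset.range L) (g := Prod.fst)
    (fun y hy => Finset.mem_range.2 (hY y hy).2.2.1)]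
  have : ∀ l ∈ Finset.range L, ∑ y ∈ Y.filter (fun y => y.1 = l),
      Real.exp (birkhoffSum f (fun x => φ x - m) y.1 y.2) ≤ 1 := by
    intro l _
    rcases (Y.filter (fun y => y.1 = l)).eq_empty_or_nonempty with h0 | ⟨y₀, hy₀⟩
    · rw [h0]; simp
    have hpre : preimSum f φ (Icc a b) l x₀ ≤ Real.exp (l * m) := by
      obtain ⟨h1, rfl⟩ := Finset.mem_filter.1 hy₀
      exact (hY y₀ h1).2.2.2
    have h1 : ∑ y ∈ Y.filter (fun y => y.1 = l),
        Real.exp (birkhoffSum f (fun x => φ x - m) y.1 y.2) = Real.exp (-(l * m)) *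
        ∑ x ∈ (Y.filter (fun y => y.1 = l)).image Prod.snd,
          Real.exp (birkhoffSum f φ l x) := by
      rw [Finset.sum_image, Finset.mul_sum]
      · refine Finset.sum_congr rfl fun y hy => ?_
        rw [(Finset.mem_filter.1 hy).2, ← Real.exp_add]
        congr 1
        simp only [birkhoffSum, Finset.sum_sub_distrib, Finset.sum_const, Finset.card_range,
          nsmul_eq_mul]
        ring
      · intro y hy y' hy' h
        exact Prod.ext ((Finset.mem_filter.1 hy).2.trans (Finset.mem_filter.1 hy').2.symm) h
    have h2 := hf.sum_le_preimSum φ l x₀ ((Y.filter (fun y => y.1 = l)).image Prod.snd)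
      fun x hx => by
        obtain ⟨y, hy, rfl⟩ := Finset.mem_image.1 hx
        obtain ⟨hyY, rfl⟩ := Finset.mem_filter.1 hy
        exact ⟨(hY y hyY).1, (hY y hyY).2.1⟩
    rw [h1]
    calc _ ≤ Real.exp (-(l * m)) * Real.exp (l * m) :=
          mul_le_mul_of_nonneg_left (h2.trans hpre) (Real.exp_pos _).le
      _ = 1 := by rw [← Real.exp_add]; simp
  refine (Finset.sum_le_sum this).trans ?_
  simp

lemma eventually_mul_lt_exp (r u : ℝ) (N : ℕ) (hr : 0 < r) :
    ∀ᶠ n : ℕ in atTop, ((n : ℝ) + 1) * (N + 1) < Real.exp (n * r - u) := by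
  have h1 : Tendsto (fun n : ℕ => Real.exp (n * (r)) / (n : ℝ)) atTop atTop := by
    have h2 := (Real.tendsto_exp_div_pow_atTop 1).comp
      (tendsto_natCast_atTop_atTop.atTop_mul_const hr)
    refine (h2.atTop_mul_const hr).congr fun n => ?_
    simp only [Function.comp_apply, pow_one]
    rcases Nat.eq_zero_or_pos n with rfl | hn
    · simp
    · have : (n : ℝ) ≠ 0 := by positivity
      field_simp
  filter_upwards [h1.eventually_gt_atTop (2 * (N + 1) * Real.exp (u)),
    eventually_ge_atTop 1] with n hn hn1
  have hn1' : (1 : ℝ) ≤ n := by exact_mod_cast hn1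
  rw [lt_div_iff₀ (by linarith)] at hn
  rw [Real.exp_sub, lt_div_iff₀ (Real.exp_pos _)]
  refine lt_of_le_of_lt ?_ hn
  have : ((n : ℝ) + 1) ≤ 2 * n := by linarith
  calc ((n : ℝ) + 1) * (N + 1) * Real.exp (u)
      ≤ (2 * n) * (N + 1) * Real.exp (u) := by gcongr
    _ = _ := by ring

/-- If Birkhoff sums of `φ` are uniformly at most about `m` per step, while some long orbit
segments nearly achieve `m` and have a positive proportion of hyperbolic times, then the
weighted preimage sums grow at a rate larger than `m`. -/
lemma lt_limsup_of_hypWeight {f φ : ℝ → ℝ} {a b : ℝ}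
    (hf : IsC3NonflatIntervalMap f a b) (hex : TopExact f (Icc a b)) (hφ : HolderOn φ (Icc a b))
    {β : ℝ} (hβ : 0 < β) {A : ℕ} {K δ₀ : ℝ} (hδ₀ : 0 < δ₀)
    (hpb : ∀ x ∈ Icc a b, (∀ j, deriv f (f^[j] x) ≠ 0) →
      ∀ s t : ℕ, 2 ≤ s → s ≤ t → IsHypTime f A K β x t →
      ∀ z ∈ Icc a b, |z - f^[t] x| ≤ δ₀ → ∃ w ∈ Icc a b, f^[t - s] w = z ∧
        ∀ i, s ≤ i → i ≤ t →
          |f^[i - s] w - f^[i] x| ≤ |z - f^[t] x| * Real.exp (-(β * (t - i : ℕ))))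
    {m γ y : ℝ} (hγ : 0 < γ) (hy : y ∈ Icc a b)
    (hup : ∀ c > 0, ∃ C, ∀ (n : ℕ), ∀ x ∈ Icc a b, birkhoffSum f φ n x ≤ n * (m + c) + C)
    (hlow : ∀ η > 0, ∀ n₀ : ℕ, ∃ n ≥ n₀, ∃ x ∈ Icc a b, (∀ j, deriv f (f^[j] x) ≠ 0) ∧
      n * (m - η) ≤ birkhoffSum f φ n x ∧ n * γ ≤ birkhoffSum f (hypWeight f A K β) n x) :
    m < atTop.limsup (fun n : ℕ => Real.log (preimSum f φ (Icc a b) n y) / n) := by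
  obtain ⟨M, hM, hMg⟩ := hf.exists_hypWeight_le A K hβ
  obtain ⟨G, hG1, hG⟩ : ∃ G : ℕ, 1 ≤ G ∧ Real.exp (-(β * G)) ≤ 1 / 8 := by
    obtain ⟨G, hG⟩ := exists_nat_ge (Real.log 8 / β)
    refine ⟨G + 1, by omega, ?_⟩
    rw [div_le_iff₀ hβ] at hG
    rw [show (1 : ℝ) / 8 = Real.exp (-Real.log 8) by
      rw [Real.exp_neg, Real.exp_log (by norm_num)]; norm_num]
    apply Real.exp_le_exp.2
    push_cast
    nlinarith
  obtain ⟨N, D, hD, htree⟩ := exists_finset_preimages_of_isHypTime hf hex hφ hβ hG1 hG (|m| + 1)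
    (P := fun x t => (∀ j, deriv f (f^[j] x) ≠ 0) ∧ 2 ≤ t ∧ IsHypTime f A K β x t) hδ₀
    (fun x hx s t hst hs ht => hpb x hx hs.1 s t hs.2.1 hst ht.2.2)
  set c₀ := Real.log (1 + Real.exp (-D)) with hc₀
  have hc₀pos : 0 < c₀ := Real.log_pos (by linarith [Real.exp_pos (-D)])
  have hexpc₀ : Real.exp c₀ = 1 + Real.exp (-D) := Real.exp_log (by positivity)
  have hGpos : (0 : ℝ) < G := by exact_mod_cast hG1
  set θ := γ / (M * G) with hθ
  have hθpos : 0 < θ := by positivity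
  set ε := min 1 (θ * c₀ / 8) with hε
  have hεpos : 0 < ε := by positivity
  have hε1 : ε ≤ 1 := min_le_left _ _
  have hε2 : ε ≤ θ * c₀ / 8 := min_le_right _ _
  refine lt_of_lt_of_le (by linarith : m < m + ε) (hf.le_limsup_preimSum hφ ?_
    fun n => hex.exists_preimage_iterate hf.lt hf.mapsTo n y hy)
  by_contra hcon
  rw [not_frequently, eventually_atTop] at hcon
  obtain ⟨l₀, hl₀⟩ := hcon
  obtain ⟨C, hC⟩ := hup ε hεpos
  have hgrow := eventually_mul_lt_exp (θ * c₀ / 2) (2 * c₀ + 2 * C + D) N (by positivity)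
  obtain ⟨n₁, hn₁⟩ := eventually_atTop.1 hgrow
  obtain ⟨n₂, hn₂⟩ := exists_nat_gt (M / γ)
  obtain ⟨n₃, hn₃⟩ := exists_nat_ge ((l₀ + 2) / θ)
  obtain ⟨n, hn, x, hx, hx0, hφn, hgn⟩ := hlow ε hεpos (max n₁ (max n₂ n₃))
  have hnn₁ : n₁ ≤ n := (le_max_left _ _).trans hn
  have hnn₂ : (n₂ : ℝ) ≤ n := by
    exact_mod_cast ((le_max_left _ _).trans (le_max_right _ _)).trans hn
  have hnn₃ : (n₃ : ℝ) ≤ n := by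
    exact_mod_cast ((le_max_right _ _).trans (le_max_right _ _)).trans hn
  have hS : M < ∑ j ∈ Finset.range n, hypWeight f A K β (f^[j] x) := by
    refine lt_of_lt_of_le ?_ hgn
    rw [div_lt_iff₀ hγ] at hn₂
    nlinarith
  obtain ⟨q, h, hsep, hhyp, hq⟩ := exists_separated_times
    (fun j => hypWeight f A K β (f^[j] x)) hM
    (fun j => hMg _ (hf.mapsTo.iterate j hx)) hG1 hS
  have hqθ : n * θ - 2 ≤ q := by
    have h1 : n * γ ≤ M * ((q + 1) * G + 1) := hgn.trans hq
    have h2 : n * γ = n * θ * (M * G) := by rw [hθ]; field_simp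
    have h3 : n * θ * (M * G) ≤ (q + 2) * (M * G) := by
      rw [← h2]
      have : M * 1 ≤ M * G := mul_le_mul_of_nonneg_left (by exact_mod_cast hG1) hM.le
      nlinarith
    have := le_of_mul_le_mul_right h3 (by positivity)
    linarith
  have hql₀ : l₀ ≤ q := by
    rw [div_le_iff₀ hθpos] at hn₃
    have : (l₀ : ℝ) ≤ q := by nlinarith
    exact_mod_cast this
  have hqh : ∀ i ≤ q, h 0 + i ≤ h i := by
    intro i
    induction i with
    | zero => simp
    | succ i ih =>
      intro hi
      have := hsep i hi
      have := ih (by omega)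
      omega
  have hqh := hqh q le_rfl
  have hhqn := (hhyp q le_rfl).2.1
  obtain ⟨Y, hY, hYsum⟩ := htree (m + ε) ((abs_add_le _ _).trans (by
    rw [abs_of_pos hεpos]; linarith)) x hx q h hsep
    (fun i hi => ⟨hx0, (hhyp i hi).1, (hhyp i hi).2.2⟩) y hy
  have hYle := hf.sum_exp_birkhoffSum_le (φ := φ) (m := m + ε) (x₀ := y) (L := (n + 1) * (N + 1)) Y
    fun z hz => by
      obtain ⟨h1, h2, h3, h4⟩ := hY z hz
      refine ⟨h1, h2, ?_, ?_⟩
      · have : (q + 1) * N ≤ (n + 1) * N := Nat.mul_le_mul_right _ (by omega)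
        have : (n + 1) * (N + 1) = (n + 1) * N + (n + 1) := by ring
        omega
      · exact (not_le.1 (hl₀ z.1 (by omega))).le
  have hmid : -(3 * (n * ε)) - 2 * C ≤ ∑ j ∈ Finset.Ico (h 0) (h q), (φ (f^[j] x) - (m + ε)) := by
    have h1 := hC (h 0) x hx
    have h2 := hC (n - h q) _ (hf.mapsTo.iterate (h q) hx)
    have h3 : birkhoffSum f φ n x = birkhoffSum f φ (h 0) x +
        ∑ j ∈ Finset.Ico (h 0) (h q), φ (f^[j] x) +
        birkhoffSum f φ (n - h q) (f^[h q] x) := by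
      have h4 : n = h q + (n - h q) := by omega
      rw [h4, birkhoffSum_add, Nat.add_sub_cancel_left]
      congr 1
      simp only [birkhoffSum]
      exact (Finset.sum_range_add_sum_Ico _ (by omega)).symm
    rw [Finset.sum_sub_distrib, Finset.sum_const, Nat.card_Ico, nsmul_eq_mul]
    have h5 : ((h q - h 0 : ℕ) : ℝ) = h q - h 0 := Nat.cast_sub (by omega)
    have h6 : ((n - h q : ℕ) : ℝ) = n - h q := Nat.cast_sub hhqn
    rw [h5]
    rw [h6] at h2
    have h7 : (h 0 : ℝ) ≤ h q := by exact_mod_cast (by omega : h 0 ≤ h q)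
    have h8 : (h q : ℝ) ≤ n := by exact_mod_cast hhqn
    have h9 : 0 ≤ n * ε := by positivity
    linarith
  have hfinal := hn₁ n hnn₁
  have hexp : Real.exp (n * (θ * c₀ / 2) - (2 * c₀ + 2 * C + D)) ≤
      Real.exp (∑ j ∈ Finset.Ico (h 0) (h q), (φ (f^[j] x) - (m + ε)) - D) *
        (1 + Real.exp (-D)) ^ q := by
    rw [← hexpc₀, ← Real.exp_nat_mul, ← Real.exp_add]
    apply Real.exp_le_exp.2
    have h1 : (n * θ - 2) * c₀ ≤ q * c₀ := mul_le_mul_of_nonneg_right hqθ hc₀pos.le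
    have h2 : n * ε ≤ n * (θ * c₀ / 8) := mul_le_mul_of_nonneg_left hε2 (Nat.cast_nonneg _)
    have h3 : 0 ≤ n * (θ * c₀) := by positivity
    linarith
  have := (hexp.trans hYsum).trans hYle
  push_cast at this
  linarith

lemma InvariantProb.exists_measurePreserving {f : ℝ → ℝ} {a b : ℝ} {ν : Measure ℝ}
    (hν : InvariantProb f (Icc a b) ν) (hab : a ≤ b) (hc : ContinuousOn f (Icc a b)) :
    ∃ F : ℝ → ℝ, MeasurePreserving F ν ν ∧ EqOn F f (Icc a b) := by
  obtain ⟨hp, h1, hinv⟩ := hν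
  have hI : ∀ᵐ x ∂ν, x ∈ Icc a b := (prob_compl_eq_zero_iff measurableSet_Icc).2 h1
  refine ⟨IccExtend hab ((Icc a b).domRestrict f), ?_, fun x hx => IccExtend_of_mem hab _ hx⟩
  have hm : Measurable (IccExtend hab ((Icc a b).domRestrict f)) :=
    (hc.domRestrict.Icc_extend').measurable
  refine ⟨hm, Measure.ext fun A hA => ?_⟩
  rw [Measure.map_apply hm hA, ← hinv A hA]
  apply measure_congr
  filter_upwards [hI] with x hx
  exact congrArg (· ∈ A) (IccExtend_of_mem hab _ hx)

lemma EqOn.iterate_eq {F f : ℝ → ℝ} {I : Set ℝ} (h : EqOn F f I) (hm : MapsTo f I I) (n : ℕ) :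
    EqOn F^[n] f^[n] I := by
  induction n with
  | zero => exact fun x _ => rfl
  | succ n ih =>
    intro x hx
    rw [Function.iterate_succ_apply, Function.iterate_succ_apply, h hx, ih (hm hx)]

lemma MeasureTheory.MeasurePreserving.integral_birkhoffSum {F : ℝ → ℝ} {ν : Measure ℝ}
    (hF : MeasurePreserving F ν ν) {u : ℝ → ℝ} (hu : Integrable u ν) (n : ℕ) :
    Integrable (fun x => birkhoffSum F u n x) ν ∧
      ∫ x, birkhoffSum F u n x ∂ν = n * ∫ x, u x ∂ν := by
  have h1 : ∀ j, Integrable (fun x => u (F^[j] x)) ν := fun j =>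
    (hF.iterate j).integrable_comp_of_integrable hu
  have h2 : ∀ j, ∫ x, u (F^[j] x) ∂ν = ∫ x, u x ∂ν := fun j => by
    have hj := hF.iterate j
    rw [← integral_map hj.measurable.aemeasurable (by rw [hj.map_eq]; exact hu.1), hj.map_eq]
  constructor
  · exact integrable_finsetSum _ fun j _ => h1 j
  · simp only [birkhoffSum]
    rw [integral_finsetSum _ fun j _ => h1 j]
    simp [h2]

lemma IsC3NonflatIntervalMap.differentiableAt_iterate {f : ℝ → ℝ} {a b : ℝ}
    (hf : IsC3NonflatIntervalMap f a b) (n : ℕ) {x : ℝ} (hx : x ∈ Icc a b) :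
    DifferentiableAt ℝ f^[n] x := by
  induction n with
  | zero => exact differentiableAt_id
  | succ n ih =>
    rw [Function.iterate_succ']
    exact (hf.diff _ (hf.mapsTo.iterate n hx)).comp x ih

lemma IsC3NonflatIntervalMap.not_isPeriodicPt_of_deriv_eq_zero {f : ℝ → ℝ} {a b : ℝ}
    (hf : IsC3NonflatIntervalMap f a b) (hex : TopExact f (Icc a b)) {c : ℝ} (hc : c ∈ Icc a b)
    (hc0 : deriv f c = 0) (p : ℕ) : f^[p + 1] c ≠ c := by
  intro hp
  have hab := hf.lt
  have hd : HasDerivAt f^[p + 1] 0 c := by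
    have h1 := (hf.differentiableAt_iterate p (hf.mapsTo hc)).hasDerivAt
    have h2 := (hf.diff c hc).hasDerivAt
    rw [hc0] at h2
    rw [Function.iterate_succ]
    simpa using h1.comp c h2
  have hev := (hasDerivAt_iff_isLittleO.1 hd).bound (c := 1 / 2) (by norm_num)
  simp only [hp, smul_zero, sub_zero, Real.norm_eq_abs] at hev
  obtain ⟨r, hr, hball⟩ := Metric.eventually_nhds_iff.1 hev
  set ε := min r ((b - a) / 4) with hε
  have hεpos : 0 < ε := lt_min hr (by linarith)
  have hεr : ε ≤ r := min_le_left _ _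
  have hεb : ε ≤ (b - a) / 4 := min_le_right _ _
  set U := ball c ε with hU
  have hUm : MapsTo f^[p + 1] (U ∩ Icc a b) (U ∩ Icc a b) := fun x hx => by
    refine ⟨?_, hf.mapsTo.iterate _ hx.2⟩
    have h1 : dist x c < ε := hx.1
    have h2 := hball (h1.trans_le hεr)
    rw [hU, mem_ball, Real.dist_eq]
    rw [Real.dist_eq] at h1
    linarith [abs_nonneg (x - c)]
  obtain ⟨n, hn, hnU⟩ := hex U isOpen_ball ⟨c, mem_ball_self hεpos, hc⟩
  have hsub : Icc a b ⊆ U := fun y hy => by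
    obtain ⟨z, hz, hzy⟩ := hex.exists_preimage_iterate hab hf.mapsTo (p * n) y hy
    rw [← hnU] at hz
    obtain ⟨x, hx, rfl⟩ := hz
    rw [← Function.iterate_add_apply, show p * n + n = (p + 1) * n by ring,
      Function.iterate_mul] at hzy
    rw [← hzy]
    exact (hUm.iterate n hx).1
  have ha := hsub (left_mem_Icc.2 hab.le)
  have hb := hsub (right_mem_Icc.2 hab.le)
  rw [hU, mem_ball, Real.dist_eq, abs_lt] at ha hb
  linarith

lemma InvariantProb.ae_deriv_iterate_ne_zero {f : ℝ → ℝ} {a b : ℝ} {ν : Measure ℝ}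
    (hν : InvariantProb f (Icc a b) ν) (hf : IsC3NonflatIntervalMap f a b)
    (hex : TopExact f (Icc a b)) : ∀ᵐ x ∂ν, ∀ j, deriv f (f^[j] x) ≠ 0 := by
  have hp := hν.1
  have hI : ∀ᵐ x ∂ν, x ∈ Icc a b := (prob_compl_eq_zero_iff measurableSet_Icc).2 hν.2.1
  obtain ⟨F, hF, hFf⟩ := hν.exists_measurePreserving hf.lt.le hf.continuousOn
  have hit := fun n => EqOn.iterate_eq hFf hf.mapsTo n
  have hcrit : ν {x | x ∈ Icc a b ∧ deriv f x = 0} = 0 := by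
    rw [measure_null_iff_singleton hf.critFinite.countable]
    rintro c ⟨hc, hc0⟩
    by_contra hne
    obtain ⟨x, hx, m, hm, hxm⟩ := hF.exists_mem_iterate_mem
      (measurableSet_singleton c).nullMeasurableSet hne
    obtain rfl : x = c := hx
    obtain ⟨k, rfl⟩ := Nat.exists_eq_succ_of_ne_zero hm
    exact hf.not_isPeriodicPt_of_deriv_eq_zero hex hc hc0 k ((hit _ hc).symm.trans hxm)
  rw [ae_all_iff]
  intro j
  have hj := (hF.iterate j).quasiMeasurePreserving.preimage_null hcrit
  filter_upwards [hI, measure_eq_zero_iff_ae_notMem.1 hj] with x hx hxj h0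
  refine hxj ⟨?_, ?_⟩
  · rw [hit j hx]; exact hf.mapsTo.iterate j hx
  · rw [hit j hx]; exact h0

lemma HolderOn.integrable {φ : ℝ → ℝ} {a b : ℝ} (hφ : HolderOn φ (Icc a b)) {ν : Measure ℝ}
    [IsProbabilityMeasure ν] (hI : ∀ᵐ x ∂ν, x ∈ Icc a b) : Integrable φ ν := by
  have hc : ContinuousOn φ (Icc a b) := by
    rw [Metric.continuousOn_iff]
    intro x hx r hr
    obtain ⟨ε, hε, h⟩ := hφ.exists_dist_le (half_pos hr)
    refine ⟨ε, hε, fun y hy hyx => ?_⟩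
    rw [Real.dist_eq] at *
    linarith [h y hy x hx hyx.le]
  have := hc.integrableOn_compact (μ := ν) isCompact_Icc
  rwa [IntegrableOn, Measure.restrict_eq_self_of_ae_mem hI] at this

lemma exists_integral_hypWeight_pos {f : ℝ → ℝ} {ν : Measure ℝ} [IsProbabilityMeasure ν]
    (hχ : 0 < ∫ x, Real.log |deriv f x| ∂ν) (A : ℕ) :
    ∃ K : ℝ, 0 ≤ K ∧
      Integrable (hypWeight f A K ((∫ x, Real.log |deriv f x| ∂ν) / 8)) ν ∧
      0 < ∫ x, hypWeight f A K ((∫ x, Real.log |deriv f x| ∂ν) / 8) x ∂ν := by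
  set χ := ∫ x, Real.log |deriv f x| ∂ν with hχdef
  have hi : Integrable (fun x => Real.log |deriv f x|) ν := by
    by_contra h
    rw [hχdef, integral_undef h] at hχ
    exact lt_irrefl _ hχ
  have hpi : ∀ K : ℝ, Integrable (fun x => max 0 (-(A * Real.log |deriv f x|) - K)) ν := fun K =>
    (integrable_zero ℝ ℝ ν).sup ((hi.const_mul (A : ℝ)).neg.sub (integrable_const K))
  have hlim : Tendsto (fun n : ℕ => ∫ x, max 0 (-(A * Real.log |deriv f x|) - n) ∂ν) atTop
      (nhds (∫ _, (0 : ℝ) ∂ν)) := by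
    refine tendsto_integral_of_dominated_convergence (fun x => abs (A * Real.log |deriv f x|))
      (fun n => (hpi n).1) (hi.const_mul (A : ℝ)).abs (fun n => ae_of_all _ fun x => ?_)
      (ae_of_all _ fun x => ?_)
    · rw [Real.norm_eq_abs, abs_of_nonneg (le_max_left _ _)]
      refine max_le (abs_nonneg _) ?_
      have := neg_le_abs (A * Real.log |deriv f x|)
      have : (0 : ℝ) ≤ n := n.cast_nonneg
      linarith
    · obtain ⟨N, hN⟩ := exists_nat_ge (-(A * Real.log |deriv f x|))
      refine tendsto_const_nhds.congr' ?_
      filter_upwards [eventually_ge_atTop N] with n hn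
      have : (N : ℝ) ≤ n := by exact_mod_cast hn
      rw [max_eq_left (by linarith)]
  rw [integral_zero] at hlim
  obtain ⟨n, hn⟩ := (hlim.eventually_lt_const (by linarith : 0 < χ / 4)).exists
  refine ⟨n, n.cast_nonneg, (hi.sub (integrable_const _)).sub (hpi n), ?_⟩
  have h1 : ∫ x, hypWeight f A n (χ / 8) x ∂ν =
      χ - 2 * (χ / 8) - ∫ x, max 0 (-(A * Real.log |deriv f x|) - n) ∂ν := by
    simp only [hypWeight]
    have hi' : Integrable (fun x => Real.log |deriv f x| - 2 * (χ / 8)) ν :=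
      hi.sub (integrable_const _)
    rw [integral_sub hi' (hpi n), integral_sub hi (integrable_const _)]
    simp [hχdef]
  rw [h1]
  linarith

/-- If Birkhoff sums of `φ` are uniformly at most about `∫ φ` per step, some long orbit segments
almost achieve `∫ φ` while the Birkhoff sums of `g` are at least half their mean. -/
lemma exists_birkhoffSum_ge {f φ g : ℝ → ℝ} {a b M : ℝ} {ν : Measure ℝ}
    (hν : InvariantProb f (Icc a b) ν) (hf : IsC3NonflatIntervalMap f a b)
    (hφ : Integrable φ ν) (hg : Integrable g ν) (hM : 0 < M) (hgM : ∀ x ∈ Icc a b, g x ≤ M)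
    (hg0 : 0 < ∫ x, g x ∂ν)
    (hup : ∀ c > 0, ∃ C, ∀ (n : ℕ), ∀ x ∈ Icc a b,
      birkhoffSum f φ n x ≤ n * ((∫ x, φ x ∂ν) + c) + C)
    {P : ℝ → Prop} (hP : ∀ᵐ x ∂ν, P x) {η : ℝ} (hη : 0 < η) (n₀ : ℕ) :
    ∃ n ≥ n₀, ∃ x ∈ Icc a b, P x ∧ n * ((∫ x, φ x ∂ν) - η) ≤ birkhoffSum f φ n x ∧
      n * ((∫ x, g x ∂ν) / 2) ≤ birkhoffSum f g n x := by
  have hp := hν.1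
  have hI : ∀ᵐ x ∂ν, x ∈ Icc a b := (prob_compl_eq_zero_iff measurableSet_Icc).2 hν.2.1
  obtain ⟨F, hF, hFf⟩ := hν.exists_measurePreserving hf.lt.le hf.continuousOn
  have hbs : ∀ (u : ℝ → ℝ) (n : ℕ), ∀ x ∈ Icc a b, birkhoffSum F u n x = birkhoffSum f u n x :=
    fun u n x hx => Finset.sum_congr rfl fun j _ =>
      congrArg u (EqOn.iterate_eq hFf hf.mapsTo j hx)
  set m := ∫ x, φ x ∂ν with hm
  set γ := ∫ x, g x ∂ν with hγ
  obtain ⟨C, hC⟩ := hup (η * γ / (4 * M)) (by positivity)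
  obtain ⟨n₁, hn₁⟩ := exists_nat_ge (M * C / (η * γ / 4))
  set n := max n₀ n₁ with hn
  refine ⟨n, le_max_left _ _, ?_⟩
  have hn₁n : (n₁ : ℝ) ≤ n := by exact_mod_cast le_max_right n₀ n₁
  have hMC : M * C ≤ n * (η * γ / 4) := by
    rw [div_le_iff₀ (by positivity)] at hn₁
    exact hn₁.trans (mul_le_mul_of_nonneg_right hn₁n (by positivity))
  obtain ⟨hφi, hφe⟩ := hF.integral_birkhoffSum hφ n
  obtain ⟨hgi, hge⟩ := hF.integral_birkhoffSum hg n
  have hN : ν {x | ¬ (x ∈ Icc a b ∧ P x)} = 0 := hI.and hP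
  obtain ⟨x, hxN, hx⟩ := exists_notMem_null_integral_le
    ((hgi.const_mul η).add (hφi.const_mul M)) hN
  have hx' : x ∈ Icc a b ∧ P x := not_not.1 hxN
  simp only [Pi.add_apply] at hx
  rw [integral_add (hgi.const_mul η) (hφi.const_mul M), integral_const_mul, integral_const_mul,
    hφe, hge, hbs _ _ _ hx'.1, hbs _ _ _ hx'.1] at hx
  have hgn : birkhoffSum f g n x ≤ n * M := by
    have : (n : ℝ) * M = ∑ j ∈ Finset.range n, M := by simp
    rw [this]
    exact Finset.sum_le_sum fun j _ => hgM _ (hf.mapsTo.iterate j hx'.1)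
  have hφn := hC n x hx'.1
  refine ⟨x, hx'.1, hx'.2, ?_, ?_⟩
  · have h1 : η * birkhoffSum f g n x ≤ η * (n * M) := mul_le_mul_of_nonneg_left hgn hη.le
    have h2 : 0 ≤ η * (n * γ) := by positivity
    refine le_of_mul_le_mul_left (a := M) ?_ hM
    linarith
  · have h1 : M * birkhoffSum f φ n x ≤ M * (n * (m + η * γ / (4 * M)) + C) :=
      mul_le_mul_of_nonneg_left hφn hM.le
    have h2 : M * (n * (m + η * γ / (4 * M)) + C) = M * (n * m) + n * (η * γ / 4) + M * C := by
      field_simp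
    refine le_of_mul_le_mul_left (a := η) ?_ hη
    linarith

lemma HolderOn.exists_birkhoffSum_le {f φ : ℝ → ℝ} {a b m : ℝ} (hφ : HolderOn φ (Icc a b))
    (hm : MapsTo f (Icc a b) (Icc a b))
    (h : ∀ c > 0, ∀ᶠ n : ℕ in atTop, ∀ x ∈ Icc a b, birkhoffSum f φ n x < n * (m + c)) :
    ∀ c > 0, ∃ C, ∀ (n : ℕ), ∀ x ∈ Icc a b, birkhoffSum f φ n x ≤ n * (m + c) + C := by
  intro c hc
  obtain ⟨B, hB, hφB⟩ := hφ.exists_abs_le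
  obtain ⟨n₀, hn₀⟩ := eventually_atTop.1 (h c hc)
  refine ⟨n₀ * (B + |m + c|), fun n x hx => ?_⟩
  have hpos : 0 ≤ B + |m + c| := by positivity
  rcases le_total n₀ n with hn | hn
  · exact (hn₀ n hn x hx).le.trans (le_add_of_nonneg_right (by positivity))
  · have h1 : birkhoffSum f φ n x ≤ n * B := by
      have : (n : ℝ) * B = ∑ j ∈ Finset.range n, B := by simp
      rw [this]
      exact Finset.sum_le_sum fun j _ => (abs_le.1 (hφB _ (hm.iterate j hx))).2
    have h2 : (n : ℝ) * (B + |m + c|) ≤ n₀ * (B + |m + c|) :=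
      mul_le_mul_of_nonneg_right (by exact_mod_cast hn) hpos
    have h3 : (n : ℝ) * -(m + c) ≤ n * |m + c| :=
      mul_le_mul_of_nonneg_left (neg_le_abs _) n.cast_nonneg
    linarith

/-- **Key Lemma.** For a topologically exact `C³` interval map with non-flat critical
points and an invariant ergodic probability measure `ν` with strictly positive Lyapunov
exponent, for every Hölder continuous `φ` there is a set of full `ν`-measure of points
`x₀` with `limsup (1/n) log Σ_{y ∈ f^{-n}(x₀)} exp(Sₙ(φ)(y)) > ∫ φ dν`. -/
theorem key_lemma
    (a b : ℝ) (f : ℝ → ℝ)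
    (hf : IsC3NonflatIntervalMap f a b)
    (hex : TopExact f (Icc a b))
    (ν : Measure ℝ) (hν : ErgodicProb f (Icc a b) ν)
    (hχ : 0 < ∫ x, Real.log |deriv f x| ∂ν)
    (φ : ℝ → ℝ) (hφ : HolderOn φ (Icc a b)) :
    ∃ X : Set ℝ, X ⊆ Icc a b ∧ ν X = 1 ∧ ∀ x₀ ∈ X,
      (∫ x, φ x ∂ν) <
        atTop.limsup (fun n : ℕ => Real.log (preimSum f φ (Icc a b) n x₀) / n) := by
  refine ⟨Icc a b, Subset.rfl, hν.1.2.1, fun y hy => ?_⟩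
  have hp := hν.1.1
  by_cases hlarge : ∃ c > 0, ∃ᶠ n : ℕ in atTop, ∃ x ∈ Icc a b,
      n * ((∫ x, φ x ∂ν) + c) ≤ birkhoffSum f φ n x
  · obtain ⟨c, hc, h⟩ := hlarge
    exact lt_limsup_of_frequently_large hf hex hφ hc hy h
  have hup := hφ.exists_birkhoffSum_le (m := ∫ x, φ x ∂ν) hf.mapsTo fun c hc => by
    have : ¬ _ := fun h => hlarge ⟨c, hc, h⟩
    simpa only [not_frequently, not_exists, not_and, not_le] using this
  have hβ : 0 < (∫ x, Real.log |deriv f x| ∂ν) / 8 := by positivity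
  obtain ⟨A, hA⟩ := hf.exists_pullback hβ
  obtain ⟨K, hK, hgi, hg0⟩ := exists_integral_hypWeight_pos hχ A
  obtain ⟨δ, hδ, hpb⟩ := hA K hK
  obtain ⟨M, hM, hgM⟩ := hf.exists_hypWeight_le A K hβ
  refine lt_limsup_of_hypWeight hf hex hφ hβ hδ hpb (half_pos hg0) hy hup fun η hη n₀ => ?_
  exact exists_birkhoffSum_ge hν.1 hf
    (hφ.integrable ((prob_compl_eq_zero_iff measurableSet_Icc).2 hν.1.2.1)) hgi hM hgM hg0 hup
    (hν.1.ae_deriv_iterate_ne_zero hf hex) hη n₀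

end
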